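/- arXiv:0811.0402 — 8 statements merged into one kernel-verified Lean document; each statement's English description precedes it below -/
import Mathlib

section
/- Let n ≥ 1 and let M be an (n+1)×(n+1) matrix over a commutative ring R. Then for all indices with 0 ≤ i < k ≤ n and 0 ≤ j < t ≤ n one has M(i;j)·M(k;t) − M(k;j)·M(i;t) = det(M)·M(i,k;j,t). -/
open Matrix

/-- The minor of an `(n+1) × (n+1)` matrix obtained by deleting row `i` and column `j`. -/
def minor1 {R : Type*} [CommRing R] {n : ℕ} (M : Matrix (Fin (n+1)) (Fin (n+1)) R)
    (i j : Fin (n+1)) : R :=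
  (M.submatrix i.succAbove j.succAbove).det

/-- The strictly monotone map `Fin (n-1) → Fin (n+1)` whose image avoids exactly the
values `i` and `k` (assuming `i < k`). -/
def skipTwo {n : ℕ} (i k : Fin (n+1)) (x : Fin (n-1)) : Fin (n+1) :=
  if (x : ℕ) < (i : ℕ) then ⟨(x : ℕ), by have := x.isLt; omega⟩
  else if (x : ℕ) + 1 < (k : ℕ) then ⟨(x : ℕ) + 1, by have := x.isLt; omega⟩
  else ⟨(x : ℕ) + 2, by have := x.isLt; omega⟩

/-- The second minor: the determinant of the matrix obtained by deleting rows `i, k`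
and columns `j, t` (for `i < k` and `j < t`). -/
def minor2 {R : Type*} [CommRing R] {n : ℕ} (M : Matrix (Fin (n+1)) (Fin (n+1)) R)
    (i k j t : Fin (n+1)) : R :=
  (M.submatrix (skipTwo i k) (skipTwo j t)).det

section Adjugate

variable {ι R : Type*} [Fintype ι] [DecidableEq ι] [CommRing R]

theorem det_one_updateCol_updateCol {j t : ι} (hjt : j ≠ t) (u v : ι → R) :
    (((1 : Matrix ι ι R).updateCol j u).updateCol t v).det = u j * v t - v j * u t := by
  have h : ((1 : Matrix ι ι R).updateCol j u).updateCol t v =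
      1 + (of ![u - Pi.single j (1 : R), v - Pi.single t 1])ᵀ *
        of ![Pi.single j (1 : R), Pi.single t 1] := by
    ext a b
    by_cases hbt : b = t
    · subst hbt
      simp [Matrix.mul_apply, Fin.sum_univ_two, one_apply, Pi.single_apply, hjt.symm]
    · by_cases hbj : b = j
      · subst hbj
        simp [Matrix.mul_apply, Fin.sum_univ_two, one_apply, Pi.single_apply, hjt]
      · simp [Matrix.mul_apply, Fin.sum_univ_two, one_apply, Pi.single_apply, hbt, hbj]
  rw [h, det_one_add_mul_comm, det_fin_two]
  simp [hjt, hjt.symm]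

/-- Jacobi's identity for `2 × 2` minors of the adjugate, up to a factor `det A`. -/
theorem det_mul_adjugate_minor_two (A : Matrix ι ι R) (i k : ι) {j t : ι} (hjt : j ≠ t) :
    A.det * (A.adjugate j i * A.adjugate t k - A.adjugate j k * A.adjugate t i) =
      A.det * (A.det * ((A.updateCol j (Pi.single i 1)).updateCol t (Pi.single k 1)).det) := by
  have hcol (l : ι) : A *ᵥ (fun a => A.adjugate a l) = A.det • Pi.single l 1 := by
    ext a
    have := congrFun (congrFun A.mul_adjugate a) l
    simpa [Matrix.mul_apply, mulVec, dotProduct, one_apply, Pi.single_apply] using this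
  rw [← det_one_updateCol_updateCol hjt (fun a => A.adjugate a i) (fun a => A.adjugate a k),
    ← det_mul, mul_updateCol, mul_updateCol, mul_one, hcol, hcol, det_updateCol_smul,
    updateCol_comm _ hjt, det_updateCol_smul, updateCol_comm _ hjt.symm]

/-- Jacobi's identity for `2 × 2` minors of the adjugate. -/
theorem adjugate_minor_two (A : Matrix ι ι R) (i k : ι) {j t : ι} (hjt : j ≠ t) :
    A.adjugate j i * A.adjugate t k - A.adjugate j k * A.adjugate t i =
      A.det * ((A.updateCol j (Pi.single i 1)).updateCol t (Pi.single k 1)).det := by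
  have hX := mul_left_cancel₀ (det_mvPolynomialX_ne_zero ι ℤ)
    (det_mul_adjugate_minor_two (mvPolynomialX ι ι ℤ) i k hjt)
  let f : MvPolynomial (ι × ι) ℤ →+* R := (MvPolynomial.aeval fun p : ι × ι => A p.1 p.2).toRingHom
  have hA : f.mapMatrix (mvPolynomialX ι ι ℤ) = A := mvPolynomialX_mapMatrix_aeval ℤ A
  have hadj (a b : ι) : f ((mvPolynomialX ι ι ℤ).adjugate a b) = A.adjugate a b := by
    rw [← hA, ← RingHom.map_adjugate]; rfl
  have hsingle (l : ι) : f ∘ Pi.single l 1 = Pi.single l 1 := by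
    ext a; simp [Pi.single_apply, apply_ite f]
  have hupd : f.mapMatrix (((mvPolynomialX ι ι ℤ).updateCol j (Pi.single i 1)).updateCol t
      (Pi.single k 1)) = (A.updateCol j (Pi.single i 1)).updateCol t (Pi.single k 1) := by
    rw [RingHom.mapMatrix_apply, map_updateCol, map_updateCol, ← RingHom.mapMatrix_apply, hA,
      hsingle, hsingle]
  simpa only [map_sub, map_mul, hadj, RingHom.map_det, hA, hupd] using congrArg f hX

end Adjugate

theorem det_updateCol_single {R : Type*} [CommRing R] {n : ℕ}
    (M : Matrix (Fin (n + 1)) (Fin (n + 1)) R) (i j : Fin (n + 1)) :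
    (M.updateCol j (Pi.single i 1)).det = (-1) ^ (i + j : ℕ) * minor1 M i j := by
  rw [← cramer_apply, cramer_eq_adjugate_mulVec, mulVec_single_one, col_apply,
    adjugate_fin_succ_eq_det_submatrix, minor1]

theorem skipTwo_eq_succAbove {m : ℕ} {i k : Fin (m + 2)} (hik : i < k) (x : Fin m) :
    skipTwo i k x = k.succAbove ((i.castPred (Fin.ne_last_of_lt hik)).succAbove x) := by
  have hik' : (i : ℕ) < k := hik
  ext
  simp only [skipTwo, Fin.succAbove, Fin.lt_def, Fin.val_castSucc, Fin.coe_castPred]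
  split_ifs <;> simp_all <;> omega

theorem det_updateCol_single_updateCol_single {R : Type*} [CommRing R] {m : ℕ}
    (M : Matrix (Fin (m + 2)) (Fin (m + 2)) R) {i k j t : Fin (m + 2)} (hik : i < k)
    (hjt : j < t) :
    ((M.updateCol j (Pi.single i 1)).updateCol t (Pi.single k 1)).det =
      (-1) ^ (i + j + (k + t) : ℕ) * minor2 M i k j t := by
  set i' := i.castPred (Fin.ne_last_of_lt hik)
  set j' := j.castPred (Fin.ne_last_of_lt hjt)
  have hi : k.succAbove i' = i := Fin.succAbove_castPred_of_lt _ _ hik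
  have hj : t.succAbove j' = j := Fin.succAbove_castPred_of_lt _ _ hjt
  have hsub : (M.updateCol j (Pi.single i 1)).submatrix k.succAbove t.succAbove =
      (M.submatrix k.succAbove t.succAbove).updateCol j' (Pi.single i' 1) := by
    ext a b
    simp only [submatrix_apply, updateCol_apply, Pi.single_apply]
    rw [← hi, ← hj]
    simp only [Fin.succAbove_right_inj]
  have hskip : minor1 (M.submatrix k.succAbove t.succAbove) i' j' = minor2 M i k j t := by
    rw [minor1, minor2, submatrix_submatrix]
    congr 2 <;> ext x <;> simp [skipTwo_eq_succAbove, hik, hjt, i', j']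
  rw [det_updateCol_single, minor1, hsub, det_updateCol_single, hskip, ← mul_assoc, ← pow_add,
    add_comm]
  rfl

/-- Theorem 1.1 (Dodgson/Desnanot–Jacobi identity):
`M(i;j)·M(k;t) − M(k;j)·M(i;t) = det(M)·M(i,k;j,t)`. -/
theorem minor1_mul_minor1_sub_eq_det_mul_minor2
    {R : Type*} [CommRing R] {n : ℕ} (hn : 1 ≤ n)
    (M : Matrix (Fin (n+1)) (Fin (n+1)) R) (i k j t : Fin (n+1))
    (hik : i < k) (hjt : j < t) :
    minor1 M i j * minor1 M k t - minor1 M k j * minor1 M i t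
      = M.det * minor2 M i k j t := by
  obtain ⟨m, rfl⟩ := Nat.exists_eq_add_of_le' hn
  have hadj (a b : Fin (m + 2)) : M.adjugate b a = (-1) ^ (a + b : ℕ) * minor1 M a b :=
    adjugate_fin_succ_eq_det_submatrix M b a
  have h := adjugate_minor_two M i k hjt.ne
  rw [det_updateCol_single_updateCol_single M hik hjt, hadj, hadj, hadj, hadj] at h
  have hsign : ((-1 : R) ^ (i + j + (k + t) : ℕ)) * (-1) ^ (i + j + (k + t) : ℕ) = 1 := by
    rw [← mul_pow]; simp
  linear_combination (-1) ^ (i + j + (k + t) : ℕ) * h -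
    (minor1 M i j * minor1 M k t - minor1 M k j * minor1 M i t - M.det * minor2 M i k j t) * hsign
end

section
/- Let n ≥ 1 and let M be an (n+1)×(n+1) matrix over a commutative ring R whose last row equals the transpose of its last column. Then det M = a_n·I_n − G_n, i.e. the determinant of the bordered matrix M satisfies I_{n+1} = a_n·I_n − Σ_{0≤i,j≤n−1} (−1)^{i+j} a_i a_j I_n(i;j). -/
open Matrix

/-- The strictly monotone map `Fin (m-1) → Fin m` whose image avoids exactly the value `i`. -/
def skipAt {m : ℕ} (i : Fin m) (x : Fin (m-1)) : Fin m :=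
  if (x : ℕ) < (i : ℕ) then ⟨(x : ℕ), by have := x.isLt; omega⟩
  else ⟨(x : ℕ) + 1, by have := x.isLt; omega⟩

/-- The top-left `n × n` block `A` of an `(n+1) × (n+1)` matrix `M`;
its determinant is `I_n`. -/
def topSq {R : Type*} [CommRing R] {n : ℕ} (M : Matrix (Fin (n+1)) (Fin (n+1)) R) :
    Matrix (Fin n) (Fin n) R :=
  M.submatrix Fin.castSucc Fin.castSucc

/-- The border entries `a_i := M_{i,n}` for `0 ≤ i ≤ n-1`. -/
def borderCoeff {R : Type*} [CommRing R] {n : ℕ} (M : Matrix (Fin (n+1)) (Fin (n+1)) R)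
    (i : Fin n) : R :=
  M i.castSucc (Fin.last n)

/-- `I_{n-1}`: the determinant of the top-left `(n-1) × (n-1)` block of `M`. -/
def Iprev {R : Type*} [CommRing R] {n : ℕ} (M : Matrix (Fin (n+1)) (Fin (n+1)) R) : R :=
  (M.submatrix (fun x : Fin (n-1) => (⟨(x : ℕ), by have := x.isLt; omega⟩ : Fin (n+1)))
     (fun x : Fin (n-1) => (⟨(x : ℕ), by have := x.isLt; omega⟩ : Fin (n+1)))).det

/-- The inclusion `Fin (n-1) → Fin n`. -/
def finCastPred {n : ℕ} (i : Fin (n-1)) : Fin n := ⟨(i : ℕ), by have := i.isLt; omega⟩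

/-- `G_n := Σ_{0 ≤ i,j ≤ n-1} (-1)^{i+j} a_i a_j I_n(i;j)`, where `I_n(i;j)` is the
determinant of the top-left `n × n` block with row `i` and column `j` deleted. -/
def Gpoly {R : Type*} [CommRing R] {n : ℕ} (M : Matrix (Fin (n+1)) (Fin (n+1)) R) : R :=
  ∑ i : Fin n, ∑ j : Fin n, (-1 : R) ^ ((i : ℕ) + (j : ℕ))
    * borderCoeff M i * borderCoeff M j
    * ((topSq M).submatrix (skipAt i) (skipAt j)).det

/-- `Li_n := a_{n-1} I_{n-1} + Σ_{i=0}^{n-2} (-1)^{i+n-1} a_i I_n(i;n-1)`. -/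
def LiL {R : Type*} [CommRing R] {n : ℕ} (M : Matrix (Fin (n+1)) (Fin (n+1)) R)
    (hn : 1 ≤ n) : R :=
  borderCoeff M ⟨n-1, by omega⟩ * Iprev M
    + ∑ i : Fin (n-1), (-1 : R) ^ ((i : ℕ) + (n-1))
        * borderCoeff M (finCastPred i)
        * ((topSq M).submatrix (skipAt (finCastPred i)) (skipAt (⟨n-1, by omega⟩ : Fin n))).det

/-- `Li'_n := a_{n-1} I_{n-1} + Σ_{j=0}^{n-2} (-1)^{j+n-1} a_j I_n(n-1;j)`. -/
def LiR {R : Type*} [CommRing R] {n : ℕ} (M : Matrix (Fin (n+1)) (Fin (n+1)) R)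
    (hn : 1 ≤ n) : R :=
  borderCoeff M ⟨n-1, by omega⟩ * Iprev M
    + ∑ j : Fin (n-1), (-1 : R) ^ ((j : ℕ) + (n-1))
        * borderCoeff M (finCastPred j)
        * ((topSq M).submatrix (skipAt (⟨n-1, by omega⟩ : Fin n)) (skipAt (finCastPred j))).det

theorem skipAt_eq_succAbove {k : ℕ} (i : Fin (k + 1)) : skipAt i = i.succAbove := by
  funext x
  simp only [skipAt, Fin.succAbove, Fin.lt_def, Fin.val_castSucc]
  split_ifs <;> rfl

theorem det_submatrix_castSucc_succAbove {R : Type*} [CommRing R] {k : ℕ}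
    (M : Matrix (Fin (k + 2)) (Fin (k + 2)) R) (j : Fin (k + 1)) :
    (M.submatrix Fin.castSucc j.castSucc.succAbove).det =
      ∑ i : Fin (k + 1), (-1 : R) ^ ((i : ℕ) + k) * borderCoeff M i *
        ((topSq M).submatrix i.succAbove j.succAbove).det := by
  rw [det_succ_column _ (Fin.last k)]
  refine Finset.sum_congr rfl fun i _ => ?_
  have hcol : j.castSucc.succAbove (Fin.last k) = Fin.last (k + 1) := by
    rw [Fin.succAbove_of_le_castSucc _ _ (Fin.castSucc_le_castSucc_iff.mpr (Fin.le_last j)),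
      Fin.succ_last]
  have hminor : (M.submatrix Fin.castSucc j.castSucc.succAbove).submatrix
      i.succAbove (Fin.last k).succAbove =
        (topSq M).submatrix i.succAbove j.succAbove := by
    ext x y
    simp [topSq]
  rw [hminor, submatrix_apply, hcol, Fin.val_last, borderCoeff]

/-- The determinant of a bordered matrix whose last row is the transpose of its last
column satisfies `I_{n+1} = a_n · I_n − G_n`. -/
theorem det_bordered_eq {R : Type*} [CommRing R] {n : ℕ} (hn : 1 ≤ n)
    (M : Matrix (Fin (n+1)) (Fin (n+1)) R)
    (hsym : ∀ i, M (Fin.last n) i = M i (Fin.last n)) :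
    M.det = M (Fin.last n) (Fin.last n) * (topSq M).det - Gpoly M := by
  obtain ⟨k, rfl⟩ := Nat.exists_eq_add_of_le' hn
  rw [det_succ_row M (Fin.last (k + 1)), Fin.sum_univ_castSucc, Gpoly, Finset.sum_comm,
    add_comm, sub_eq_add_neg, ← Finset.sum_neg_distrib]
  simp only [Fin.succAbove_last, skipAt_eq_succAbove]
  congr 1
  · rw [← two_mul, pow_mul, neg_one_sq, one_pow, one_mul, topSq]
  · refine Finset.sum_congr rfl fun j _ => ?_
    rw [det_submatrix_castSucc_succAbove, Finset.mul_sum, ← Finset.sum_neg_distrib]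
    refine Finset.sum_congr rfl fun i _ => ?_
    have hsign : (-1 : R) ^ (k + 1 + (j : ℕ)) * (-1) ^ ((i : ℕ) + k) =
        -(-1) ^ ((i : ℕ) + j) := by
      have hk : (-1 : R) ^ k * (-1) ^ k = 1 := by rw [← mul_pow]; simp
      simp only [pow_add, pow_one]
      linear_combination (-(-1 : R) ^ (i : ℕ) * (-1) ^ (j : ℕ)) * hk
    rw [hsym, Fin.val_last, Fin.val_castSucc]
    change _ * borderCoeff M j * _ = _
    linear_combination (borderCoeff M i * borderCoeff M j *
      ((topSq M).submatrix i.succAbove j.succAbove).det) * hsign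
end

section
/- Let n ≥ 2 and let M be a symmetric (n+1)×(n+1) matrix over a commutative ring R. Assume that the quotient ring R/(I_n) is an integral domain and that I_{n−1} lies in the ideal of R generated by I_n. Then G_n − ( Σ_{i=0}^{n−2} a_i²·I_n(i;i) + 2·Σ_{0≤i<j≤n−2} (−1)^{i+j} a_i a_j·I_n(i;j) ) lies in the ideal of R generated by I_n; in other words, modulo I_n the polynomial G_n is independent of a_{n−1}. -/
open Matrix

/-- Over a domain, if a symmetric singular matrix has a vanishing diagonal cofactor, then all
cofactors in the same column vanish. -/
theorem adjugate_apply_eq_zero_of_isSymm {ι S : Type*} [Fintype ι] [DecidableEq ι] [CommRing S]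
    [IsDomain S] {B : Matrix ι ι S} (hB : B.IsSymm) (hdet : B.det = 0) {l : ι}
    (hl : B.adjugate l l = 0) (i : ι) : B.adjugate i l = 0 := by
  by_contra hc
  have hker (k : ι) : ∑ j, B k j * B.adjugate j l = 0 := by
    rw [← Matrix.mul_apply, Matrix.mul_adjugate, hdet, zero_smul, Matrix.zero_apply]
  apply hc
  rw [← hB.adjugate.apply i l, Matrix.adjugate_apply, ← Matrix.exists_mulVec_eq_zero_iff]
  refine ⟨fun j => B.adjugate j l, fun h => hc (congrFun h i), funext fun k => ?_⟩
  rcases eq_or_ne k i with rfl | hk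
  · simp [Matrix.mulVec, hl]
  · simpa [Matrix.mulVec, dotProduct, Matrix.updateRow_ne hk] using hker k

/-- A double sum of a symmetric function is its diagonal part plus twice its part above the
diagonal. -/
theorem sum_sum_eq_sum_diag_add_two_mul_sum_lt {ι R : Type*} [Fintype ι] [LinearOrder ι]
    [CommSemiring R] (f : ι → ι → R) (hf : ∀ i j, f i j = f j i) :
    ∑ i, ∑ j, f i j = ∑ i, f i i + 2 * ∑ i, ∑ j, if i < j then f i j else 0 := by
  have hsplit (i j : ι) : f i j = (if i = j then f i j else 0) + (if i < j then f i j else 0)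
      + (if j < i then f j i else 0) := by
    rcases lt_trichotomy i j with h | rfl | h
    · simp [h, h.ne, h.not_gt]
    · simp
    · simp [h, h.ne', h.not_gt, hf i j]
  have hswap : ∑ i, ∑ j, (if j < i then f j i else 0) = ∑ i, ∑ j, if i < j then f i j else 0 :=
    Finset.sum_comm
  rw [Finset.sum_congr rfl fun i _ => Finset.sum_congr rfl fun j _ => hsplit i j]
  simp only [Finset.sum_add_distrib, hswap, Finset.sum_ite_eq, Finset.mem_univ, if_true]
  ring

theorem finCastPred_eq_castSucc {k : ℕ} (i : Fin k) :
    finCastPred (n := k + 1) i = i.castSucc := rfl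

theorem Iprev_eq_adjugate_last {R : Type*} [CommRing R] {k : ℕ}
    (M : Matrix (Fin (k + 1 + 1)) (Fin (k + 1 + 1)) R) :
    Iprev M = (topSq M).adjugate (Fin.last k) (Fin.last k) := by
  rw [Matrix.adjugate_fin_succ_eq_det_submatrix, Even.neg_one_pow ⟨_, rfl⟩, one_mul,
    Fin.succAbove_last]
  rfl

theorem neg_one_pow_mul_det_skipAt {R : Type*} [CommRing R] {k : ℕ}
    (A : Matrix (Fin (k + 1)) (Fin (k + 1)) R) (a b : R) (i j : Fin (k + 1)) :
    (-1 : R) ^ ((i : ℕ) + (j : ℕ)) * a * b * (A.submatrix (skipAt i) (skipAt j)).det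
      = a * b * A.adjugate j i := by
  rw [Matrix.adjugate_fin_succ_eq_det_submatrix, skipAt_eq_succAbove, skipAt_eq_succAbove]
  ring

theorem det_skipAt_self {R : Type*} [CommRing R] {k : ℕ}
    (A : Matrix (Fin (k + 1)) (Fin (k + 1)) R) (i : Fin (k + 1)) :
    (A.submatrix (skipAt i) (skipAt i)).det = A.adjugate i i := by
  rw [Matrix.adjugate_fin_succ_eq_det_submatrix, skipAt_eq_succAbove,
    Even.neg_one_pow ⟨_, rfl⟩, one_mul]

/-- Theorem 1.5: for a symmetric matrix with `R/(I_n)` a domain and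
`I_{n-1} ≡ 0 (mod I_n)`, one has
`G_n ≡ Σ_{i≤n-2} a_i² I_n(i;i) + 2 Σ_{0≤i<j≤n-2} (-1)^{i+j} a_i a_j I_n(i;j) (mod I_n)`;
in particular, modulo `I_n` the polynomial `G_n` is independent of `a_{n-1}`. -/
theorem Gpoly_congr_of_Iprev_mem {R : Type*} [CommRing R] {n : ℕ} (hn : 2 ≤ n)
    (M : Matrix (Fin (n+1)) (Fin (n+1)) R) (hsym : M.IsSymm)
    (hdom : IsDomain (R ⧸ Ideal.span {(topSq M).det}))
    (hprev : Iprev M ∈ Ideal.span {(topSq M).det}) :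
    Gpoly M -
      ((∑ i : Fin (n-1), borderCoeff M (finCastPred i) ^ 2
          * ((topSq M).submatrix (skipAt (finCastPred i)) (skipAt (finCastPred i))).det)
        + 2 * ∑ i : Fin (n-1), ∑ j : Fin (n-1),
            if i < j then
              (-1 : R) ^ ((i : ℕ) + (j : ℕ))
                * borderCoeff M (finCastPred i) * borderCoeff M (finCastPred j)
                * ((topSq M).submatrix (skipAt (finCastPred i)) (skipAt (finCastPred j))).det
            else 0)
      ∈ Ideal.span {(topSq M).det} := by
  obtain ⟨k, rfl⟩ : ∃ k, n = k + 1 := ⟨n - 1, by omega⟩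
  set I := Ideal.span {(topSq M).det}
  have hA : (topSq M).IsSymm := hsym.submatrix Fin.castSucc
  have hlast (i : Fin (k + 1)) : (topSq M).adjugate i (Fin.last k) ∈ I := by
    let q := Ideal.Quotient.mk I
    have hmap (i j : Fin (k + 1)) :
        ((topSq M).map q).adjugate i j = q ((topSq M).adjugate i j) :=
      (congrFun (congrFun (q.map_adjugate (topSq M)) i) j).symm
    rw [← Ideal.Quotient.eq_zero_iff_mem, ← hmap]
    refine adjugate_apply_eq_zero_of_isSymm (hA.map q) ?_ ?_ i
    · refine (q.map_det (topSq M)).symm.trans ?_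
      exact Ideal.Quotient.eq_zero_iff_mem.mpr (Ideal.mem_span_singleton_self _)
    · rw [hmap, ← Iprev_eq_adjugate_last]
      exact Ideal.Quotient.eq_zero_iff_mem.mpr hprev
  have hsum := sum_sum_eq_sum_diag_add_two_mul_sum_lt
    (fun i j : Fin k => borderCoeff M i.castSucc * borderCoeff M j.castSucc
      * (topSq M).adjugate j.castSucc i.castSucc)
    fun i j => by rw [hA.adjugate.apply]; ring
  have hdiff : Gpoly M -
      (∑ i : Fin k, ∑ j : Fin k, borderCoeff M i.castSucc * borderCoeff M j.castSucc
        * (topSq M).adjugate j.castSucc i.castSucc)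
      = ∑ i : Fin k, borderCoeff M i.castSucc * borderCoeff M (Fin.last k)
            * (topSq M).adjugate i.castSucc (Fin.last k)
        + ∑ j : Fin (k + 1), borderCoeff M (Fin.last k) * borderCoeff M j
            * (topSq M).adjugate j (Fin.last k) := by
    simp only [Gpoly, neg_one_pow_mul_det_skipAt]
    rw [Fin.sum_univ_castSucc, Finset.sum_congr rfl fun i _ => Fin.sum_univ_castSucc _,
      Finset.sum_add_distrib, add_assoc, add_sub_cancel_left]
    simp only [fun i : Fin k => hA.adjugate.apply i.castSucc (Fin.last k)]
  have htarget :
      ((∑ i : Fin k, borderCoeff M (finCastPred (n := k + 1) i) ^ 2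
          * ((topSq M).submatrix (skipAt (finCastPred i)) (skipAt (finCastPred i))).det)
        + 2 * ∑ i : Fin k, ∑ j : Fin k,
            if i < j then
              (-1 : R) ^ ((i : ℕ) + (j : ℕ))
                * borderCoeff M (finCastPred (n := k + 1) i)
                * borderCoeff M (finCastPred (n := k + 1) j)
                * ((topSq M).submatrix (skipAt (finCastPred i)) (skipAt (finCastPred j))).det
            else 0)
      = ∑ i : Fin k, ∑ j : Fin k, borderCoeff M i.castSucc * borderCoeff M j.castSucc
        * (topSq M).adjugate j.castSucc i.castSucc := by
    have hterm (a b : R) (i j : Fin k) :=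
      neg_one_pow_mul_det_skipAt (topSq M) a b i.castSucc j.castSucc
    simp only [Fin.val_castSucc] at hterm
    simp only [hsum, finCastPred_eq_castSucc, det_skipAt_self, sq, hterm]
  refine (congrArg (fun x => Gpoly M - x ∈ I) htarget).mpr ?_
  rw [hdiff]
  exact I.add_mem (I.sum_mem fun i _ => I.mul_mem_left _ (hlast _))
    (I.sum_mem fun j _ => I.mul_mem_left _ (hlast _))
end

section
/- The projection forgetting the coordinate x_{n−1}, from the projective space ℙ^{m−1} over K with homogeneous coordinates (x₀ : … : x_{n−2} : x_{n−1} : x_{n+1} : … : x_m) to the projective space ℙ^{m−2} with homogeneous coordinates (x₀ : … : x_{n−2} : x_{n+1} : … : x_m), restricts to a bijection from the locally closed set U₁ = { points of ℙ^{m−1} at which I_n = 0, Li_n = 0 and I_{n−1} ≠ 0 } onto the locally closed set U₂ = { points of ℙ^{m−2} at which I_n = 0 and I_{n−1} ≠ 0 }. -/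
open Matrix

open MvPolynomial

/-- Extend a vector `v : Fin a → K` to a vector `Fin b → K` by inserting a zero
coordinate at position `pos` (all coordinates at indices `≥ pos` are shifted up by one;
out-of-range indices are sent to `0`).  For `b = a + 1` and `pos ≤ a` this is exactly
"insert a zero at slot `pos`". -/
def insZero {K : Type*} [Zero K] (pos : ℕ) {a b : ℕ} (v : Fin a → K) : Fin b → K :=
  fun idx =>
    if (idx : ℕ) < pos then (if h : (idx : ℕ) < a then v ⟨(idx : ℕ), h⟩ else 0)
    else if (idx : ℕ) = pos then 0
    else if h : (idx : ℕ) - 1 < a then v ⟨(idx : ℕ) - 1, h⟩ else 0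

/-- Two points that agree away from a coordinate not occurring in `f` give `f` the same value. -/
theorem eval_eq_of_notMem_vars {σ K : Type*} [CommRing K] {f : MvPolynomial σ K} {a : σ}
    (hf : a ∉ f.vars) {x y : σ → K} (hxy : ∀ i, i ≠ a → x i = y i) : eval x f = eval y f := by
  refine eval₂Hom_congr' rfl (fun i hi _ => hxy i ?_) rfl
  rintro rfl
  exact hf hi

theorem eval_det_eq_of_notMem_vars {σ ι K : Type*} [CommRing K] [Fintype ι] [DecidableEq ι]
    {N : Matrix ι ι (MvPolynomial σ K)} {a : σ} (hN : ∀ p q, a ∉ (N p q).vars) {x y : σ → K}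
    (hxy : ∀ i, i ≠ a → x i = y i) : eval x N.det = eval y N.det := by
  rw [RingHom.map_det, RingHom.map_det]
  congr 1
  ext p q
  exact eval_eq_of_notMem_vars (hN p q) hxy

theorem MvPolynomial.IsHomogeneous.eval_smul_one {σ K : Type*} [CommRing K]
    {f : MvPolynomial σ K} (hf : f.IsHomogeneous 1) (c : K) (x : σ → K) :
    eval (c • x) f = c * eval x f := by
  rw [eval_eq, eval_eq, Finset.mul_sum]
  refine Finset.sum_congr rfl fun d hd => ?_
  have hdeg : ∑ i ∈ d.support, d i = 1 := by
    rw [← Finsupp.degree_apply, Finsupp.degree_eq_weight_one]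
    exact hf (mem_support_iff.mp hd)
  simp only [Pi.smul_apply, smul_eq_mul, mul_pow, Finset.prod_mul_distrib,
    Finset.prod_pow_eq_pow_sum, hdeg, pow_one]
  ring

theorem eval_smul_det_of_isHomogeneous_one {σ ι K : Type*} [CommRing K] [Fintype ι]
    [DecidableEq ι] {N : Matrix ι ι (MvPolynomial σ K)} (hN : ∀ p q, (N p q).IsHomogeneous 1)
    (c : K) (x : σ → K) : eval (c • x) N.det = c ^ Fintype.card ι * eval x N.det := by
  rw [RingHom.map_det, RingHom.map_det, ← det_smul]
  congr 1
  ext p q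
  exact (hN p q).eval_smul_one c x

/-- If a hypersurface is given by `l * P + S = 0`, with `D`, `P`, `S` homogeneous functions pulled
back along the projection `π`, whose forgotten coordinate is `l`, then `π` restricts to a
bijection over `P ≠ 0`, since the equation determines `l`. -/
theorem bijOn_projectivization_of_linear_equation {K V W : Type*} [Field K]
    [AddCommGroup V] [Module K V] [AddCommGroup W] [Module K W]
    (π : V →ₗ[K] W) (l : V →ₗ[K] K)
    (hinj : ∀ v w, π v = π w → l v = l w → v = w)
    (hsurj : ∀ u t, ∃ v, π v = u ∧ l v = t)
    {D P S : W → K} {d k : ℕ} (hk : k ≠ 0)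
    (hD : ∀ (c : K) u, D (c • u) = c ^ d * D u)
    (hP : ∀ (c : K) u, P (c • u) = c ^ k * P u)
    (hS : ∀ (c : K) u, S (c • u) = c ^ (k + 1) * S u)
    (f : Projectivization K V → Projectivization K W)
    (hf : ∀ p (h : π p.rep ≠ 0), f p = Projectivization.mk K (π p.rep) h) :
    Set.BijOn f
      {p | D (π p.rep) = 0 ∧ l p.rep * P (π p.rep) + S (π p.rep) = 0 ∧ P (π p.rep) ≠ 0}
      {q | D q.rep = 0 ∧ P q.rep ≠ 0} := by
  have ne_zero_of_P : ∀ u, P u ≠ 0 → u ≠ 0 := by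
    rintro u hu rfl
    refine hu ?_
    simpa [hk] using hP 0 0
  refine ⟨?_, ?_, ?_⟩
  · rintro p ⟨h1, -, h3⟩
    have hne := ne_zero_of_P _ h3
    obtain ⟨a, ha⟩ := Projectivization.exists_smul_eq_mk_rep K (π p.rep) hne
    rw [hf p hne, Set.mem_ofPred_eq, ← ha, Units.smul_def, hD, hP]
    exact ⟨by rw [h1, mul_zero], mul_ne_zero (pow_ne_zero _ a.ne_zero) h3⟩
  · rintro p ⟨-, hp2, hp3⟩ q ⟨-, hq2, hq3⟩ hpq
    rw [hf p (ne_zero_of_P _ hp3), hf q (ne_zero_of_P _ hq3),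
      Projectivization.mk_eq_mk_iff'] at hpq
    obtain ⟨a, ha⟩ := hpq
    have ha0 : a ≠ 0 := by
      rintro rfl
      exact ne_zero_of_P _ hp3 (by rw [← ha, zero_smul])
    rw [← p.mk_rep, ← q.mk_rep, Projectivization.mk_eq_mk_iff']
    refine ⟨a, hinj _ _ (by rw [map_smul, ha]) ?_⟩
    rw [← ha, hP, hS] at hp2
    rw [map_smul, smul_eq_mul]
    refine mul_right_cancel₀ (mul_ne_zero (pow_ne_zero k ha0) hq3) ?_
    linear_combination a ^ (k + 1) * hq2 - hp2
  · rintro q ⟨hq1, hq2⟩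
    obtain ⟨v, hv, hl⟩ := hsurj q.rep (-S q.rep / P q.rep)
    have hv0 : v ≠ 0 := by
      rintro rfl
      exact ne_zero_of_P _ hq2 (by rw [← hv, map_zero])
    obtain ⟨a, ha⟩ := Projectivization.exists_smul_eq_mk_rep K v hv0
    rw [Units.smul_def] at ha
    have hP' : P (π (Projectivization.mk K v hv0).rep) ≠ 0 := by
      rw [← ha, map_smul, hv, hP]
      exact mul_ne_zero (pow_ne_zero _ a.ne_zero) hq2
    refine ⟨Projectivization.mk K v hv0, ⟨?_, ?_, hP'⟩, ?_⟩
    · rw [← ha, map_smul, hv, hD, hq1, mul_zero]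
    · rw [← ha, map_smul, map_smul, hv, hl, hP, hS, smul_eq_mul]
      field_simp
      ring
    · rw [hf _ (ne_zero_of_P _ hP')]
      conv_rhs => rw [← q.mk_rep]
      rw [Projectivization.mk_eq_mk_iff']
      exact ⟨a, by rw [← ha, map_smul, hv]⟩

theorem insZero_smul {K : Type*} [Field K] (pos : ℕ) {a b : ℕ} (c : K) (v : Fin a → K) :
    (insZero pos (c • v) : Fin b → K) = c • insZero pos v := by
  ext i
  simp only [insZero, Pi.smul_apply, smul_eq_mul]
  split_ifs <;> simp

theorem insZero_skipAt {K : Type*} [Zero K] {m : ℕ} (i : Fin m) (u : Fin (m-1) → K)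
    (j : Fin (m-1)) : insZero (i : ℕ) u (skipAt i j) = u j := by
  have := j.isLt
  by_cases h : (j : ℕ) < i
  · simp [insZero, skipAt, h]
  · have h1 : ¬ (j : ℕ) + 1 < i := by omega
    have h2 : ¬ (j : ℕ) + 1 = i := by omega
    simp [insZero, skipAt, h, h1, h2]

theorem skipAt_ne {m : ℕ} (i : Fin m) (j : Fin (m-1)) : skipAt i j ≠ i := by
  unfold skipAt
  split_ifs with h <;> simp only [ne_eq, Fin.ext_iff] <;> omega

theorem exists_skipAt_eq {m : ℕ} {i k : Fin m} (h : k ≠ i) : ∃ j, skipAt i j = k := by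
  have hne : (k : ℕ) ≠ i := fun hc => h (Fin.ext hc)
  have := k.isLt
  have := i.isLt
  rcases lt_or_gt_of_ne hne with hlt | hgt
  · exact ⟨⟨k, by omega⟩, by simp [skipAt, hlt]⟩
  · refine ⟨⟨k - 1, by omega⟩, ?_⟩
    have h1 : ¬ (k : ℕ) - 1 < i := by omega
    simp only [skipAt, h1, if_false, Fin.ext_iff]
    omega

theorem insZero_insZero_skipAt {K : Type*} [Zero K] {m : ℕ} (pos : ℕ) (i : Fin m) (v : Fin m → K)
    (hpos : (i : ℕ) < pos) (k : Fin (m+1)) (hk : (k : ℕ) ≠ i) :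
    (insZero pos v : Fin (m+1) → K) k =
      insZero pos (insZero (i : ℕ) (fun j => v (skipAt i j)) : Fin m → K) k := by
  have key : ∀ l : Fin m, l ≠ i → v l = insZero (i : ℕ) (fun j => v (skipAt i j)) l := by
    intro l hl
    obtain ⟨j, rfl⟩ := exists_skipAt_eq hl
    rw [insZero_skipAt]
  generalize (insZero (i : ℕ) (fun j => v (skipAt i j)) : Fin m → K) = w at key ⊢
  unfold insZero
  split_ifs
  all_goals first
    | rfl
    | exact key _ (by simp only [ne_eq, Fin.ext_iff]; omega)

/-- The part of `Li_n` not involving the border entry `a_{n-1}`. -/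
def LiTail {R : Type*} [CommRing R] {n : ℕ} (M : Matrix (Fin (n+1)) (Fin (n+1)) R)
    (hn : 1 ≤ n) : R :=
  ∑ i : Fin (n-1), (-1 : R) ^ ((i : ℕ) + (n-1))
    * borderCoeff M (finCastPred i)
    * ((topSq M).submatrix (skipAt (finCastPred i)) (skipAt (⟨n-1, by omega⟩ : Fin n))).det

theorem LiL_eq {R : Type*} [CommRing R] {n : ℕ} (M : Matrix (Fin (n+1)) (Fin (n+1)) R)
    (hn : 1 ≤ n) : LiL M hn = borderCoeff M ⟨n-1, by omega⟩ * Iprev M + LiTail M hn :=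
  rfl

section Evaluation

variable {K σ : Type*} [CommRing K] {n : ℕ}
  {M : Matrix (Fin (n+1)) (Fin (n+1)) (MvPolynomial σ K)}

theorem eval_Iprev_eq_of_notMem_vars {a : σ} (hblock : ∀ p q : Fin n, a ∉ (topSq M p q).vars)
    {x y : σ → K} (hxy : ∀ i, i ≠ a → x i = y i) : eval x (Iprev M) = eval y (Iprev M) := by
  unfold Iprev
  exact eval_det_eq_of_notMem_vars (fun p q => hblock (finCastPred p) (finCastPred q)) hxy

theorem eval_LiTail_eq_of_notMem_vars (hn : 1 ≤ n) {a : σ}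
    (hblock : ∀ p q : Fin n, a ∉ (topSq M p q).vars)
    (hborder : ∀ i : Fin (n-1), a ∉ (borderCoeff M (finCastPred i)).vars)
    {x y : σ → K} (hxy : ∀ i, i ≠ a → x i = y i) :
    eval x (LiTail M hn) = eval y (LiTail M hn) := by
  simp only [LiTail, map_sum, map_mul, map_pow, map_neg, map_one]
  refine Finset.sum_congr rfl fun j _ => ?_
  congr 1
  · rw [eval_eq_of_notMem_vars (hborder j) hxy]
  · exact eval_det_eq_of_notMem_vars (fun p q => hblock _ _) hxy

theorem eval_smul_Iprev (hlin : ∀ p q, (M p q).IsHomogeneous 1) (c : K) (x : σ → K) :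
    eval (c • x) (Iprev M) = c ^ (n-1) * eval x (Iprev M) := by
  unfold Iprev
  rw [eval_smul_det_of_isHomogeneous_one (fun p q => by exact hlin _ _), Fintype.card_fin]

theorem eval_smul_LiTail (hn : 1 ≤ n) (hlin : ∀ p q, (M p q).IsHomogeneous 1) (c : K)
    (x : σ → K) : eval (c • x) (LiTail M hn) = c ^ (n-1+1) * eval x (LiTail M hn) := by
  simp only [LiTail, map_sum, map_mul, map_pow, map_neg, map_one, Finset.mul_sum]
  refine Finset.sum_congr rfl fun j _ => ?_
  have hb : (borderCoeff M (finCastPred j)).IsHomogeneous 1 := hlin _ _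
  rw [hb.eval_smul_one, eval_smul_det_of_isHomogeneous_one (fun p q => by exact hlin _ _),
    Fintype.card_fin]
  ring

end Evaluation

open scoped Classical in
/-- Theorem 1.7.  Work in `R = K[x₀,…,x_m]` with a symmetric `(n+1)×(n+1)` matrix `M`
of linear forms, with `a_{n-1} = x_{n-1}` and all other relevant entries independent of
`x_{n-1}` and `x_n`.  A point of `ℙ^{m-1}` (coordinates `x₀,…,x_{n-1},x_{n+1},…,x_m`,
i.e. omitting `x_n`) is encoded as a point of `Projectivization K (Fin m → K)`, a
polynomial being evaluated there by inserting a zero at slot `n`; a point of `ℙ^{m-2}`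
(further omitting `x_{n-1}`) is encoded as a point of
`Projectivization K (Fin (m-1) → K)`, evaluation inserting zeros at slots `n-1` and `n`.
The projection forgetting the coordinate `x_{n-1}` restricts to a bijection from
`U₁ = {I_n = 0, Li_n = 0, I_{n-1} ≠ 0} ⊆ ℙ^{m-1}` onto
`U₂ = {I_n = 0, I_{n-1} ≠ 0} ⊆ ℙ^{m-2}`. -/
theorem projection_bijOn {K : Type*} [Field K] [IsAlgClosed K] [CharZero K]
    (n m : ℕ) (hn : 2 ≤ n) (hm : n ≤ m)
    (M : Matrix (Fin (n+1)) (Fin (n+1)) (MvPolynomial (Fin (m+1)) K))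
    (hsymm : M.IsSymm)
    (hlin : ∀ p q, (M p q).IsHomogeneous 1)
    (hlast : borderCoeff M ⟨n-1, by omega⟩ = X (⟨n-1, by omega⟩ : Fin (m+1)))
    (hblock : ∀ p q : Fin n,
      (⟨n-1, by omega⟩ : Fin (m+1)) ∉ (topSq M p q).vars ∧
      (⟨n, by omega⟩ : Fin (m+1)) ∉ (topSq M p q).vars)
    (hborder : ∀ i : Fin (n-1),
      (⟨n-1, by omega⟩ : Fin (m+1)) ∉ (borderCoeff M (finCastPred i)).vars ∧
      (⟨n, by omega⟩ : Fin (m+1)) ∉ (borderCoeff M (finCastPred i)).vars) :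
    Set.BijOn
      (fun p : Projectivization K (Fin m → K) =>
        if h : (fun jj : Fin (m-1) => p.rep (skipAt (⟨n-1, by omega⟩ : Fin m) jj)) ≠ 0
        then Projectivization.mk K _ h
        else Projectivization.mk K (fun _ => (1 : K))
          (by intro hc; have h0 := congrFun hc ⟨0, by omega⟩; simp at h0))
      {p : Projectivization K (Fin m → K) |
        eval (insZero n p.rep : Fin (m+1) → K) ((topSq M).det) = 0 ∧
        eval (insZero n p.rep : Fin (m+1) → K) (LiL M (by omega)) = 0 ∧
        eval (insZero n p.rep : Fin (m+1) → K) (Iprev M) ≠ 0}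
      {q : Projectivization K (Fin (m-1) → K) |
        eval (insZero n (insZero (n-1) q.rep : Fin m → K) : Fin (m+1) → K) ((topSq M).det) = 0 ∧
        eval (insZero n (insZero (n-1) q.rep : Fin m → K) : Fin (m+1) → K) (Iprev M) ≠ 0} := by
  classical
  have hi : n - 1 < m := by omega
  have hn1 : 1 ≤ n := by omega
  set i : Fin m := ⟨n - 1, hi⟩ with hidef
  obtain ⟨z, hz⟩ : ∃ z : (Fin (m-1) → K) → Fin (m+1) → K,
      ∀ u, z u = insZero n (insZero (n-1) u : Fin m → K) := ⟨_, fun _ => rfl⟩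
  have hzsmul : ∀ (c : K) u, z (c • u) = c • z u := fun c u => by
    rw [hz, hz, insZero_smul, insZero_smul]
  have hagree : ∀ (v : Fin m → K) (k : Fin (m+1)), k ≠ ⟨n - 1, by omega⟩ →
      (insZero n v : Fin (m+1) → K) k = z (fun j => v (skipAt i j)) k := fun v k hk => by
    rw [hz]
    exact insZero_insZero_skipAt n i v (by simp only [hidef]; omega) k (fun h => hk (Fin.ext h))
  have hdet : ∀ v : Fin m → K, eval (insZero n v : Fin (m+1) → K) (topSq M).det =
      eval (z fun j => v (skipAt i j)) (topSq M).det := fun v =>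
    eval_det_eq_of_notMem_vars (fun p q => (hblock p q).1) (hagree v)
  have hprev : ∀ v : Fin m → K, eval (insZero n v : Fin (m+1) → K) (Iprev M) =
      eval (z fun j => v (skipAt i j)) (Iprev M) := fun v =>
    eval_Iprev_eq_of_notMem_vars (fun p q => (hblock p q).1) (hagree v)
  have hLi : ∀ v : Fin m → K, eval (insZero n v : Fin (m+1) → K) (LiL M hn1) =
      v i * eval (z fun j => v (skipAt i j)) (Iprev M) +
        eval (z fun j => v (skipAt i j)) (LiTail M hn1) := fun v => by
    rw [← hprev, ← eval_LiTail_eq_of_notMem_vars hn1 (fun p q => (hblock p q).1)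
      (fun j => (hborder j).1) (hagree v), LiL_eq, hlast, map_add, map_mul, eval_X]
    congr 2
    have h1 : n - 1 < n := by omega
    simp [insZero, h1, hi, hidef]
  simp only [hdet, hprev, hLi, ← hz]
  refine bijOn_projectivization_of_linear_equation (LinearMap.funLeft K K (skipAt i))
    (LinearMap.proj i) (fun v w h1 h2 => ?_) (fun u t => ?_)
    (D := fun u => eval (z u) (topSq M).det) (P := fun u => eval (z u) (Iprev M))
    (S := fun u => eval (z u) (LiTail M hn1)) (d := n) (k := n - 1) (by omega)
    (fun c u => ?_) (fun c u => ?_) (fun c u => ?_) _ (fun p h => dif_pos h)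
  · ext k
    by_cases hk : k = i
    · rw [hk]
      exact h2
    · obtain ⟨j, rfl⟩ := exists_skipAt_eq hk
      exact congrFun h1 j
  · refine ⟨Function.update (insZero (i : ℕ) u) i t, ?_, by simp⟩
    ext j
    rw [LinearMap.funLeft_apply, Function.update_of_ne (skipAt_ne i j), insZero_skipAt]
  · have htop : ∀ p q, (topSq M p q).IsHomogeneous 1 := fun p q => hlin _ _
    simpa only [hzsmul, Fintype.card_fin] using eval_smul_det_of_isHomogeneous_one htop c (z u)
  · simpa only [hzsmul] using eval_smul_Iprev hlin c (z u)
  · simpa only [hzsmul] using eval_smul_LiTail hn1 hlin c (z u)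
end

section
/- Let Γ be a finite connected directed multigraph and let h₁,…,h_r be a ℤ-basis of H₁(Γ,ℤ). Then, in the polynomial ring ℤ[A_e : e ∈ E], the graph polynomial satisfies Ψ_Γ = det( Σ_{e∈E} A_e·M_e ) = Σ_{T a spanning tree of Γ} Π_{e ∉ T} A_e, where the sum runs over all spanning trees T of Γ. -/
open MvPolynomial

/-- The boundary map `∂ : ℤ[E] → ℤ[V]` of a directed multigraph with source map `s`
and target map `t`: the basis vector of an edge `e` is sent to `s(e) − t(e)`. -/
def graphBoundary {E V : Type*} [Fintype E] [DecidableEq V] (s t : E → V)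
    (f : E → ℤ) : V → ℤ :=
  fun v => ∑ e : E, f e * ((if s e = v then 1 else 0) - (if t e = v then 1 else 0))

/-- Two vertices are joined by an edge of `T` (traversed in either direction). -/
def EdgeStep {E V : Type*} (s t : E → V) (T : Finset E) (a b : V) : Prop :=
  ∃ e ∈ T, (s e = a ∧ t e = b) ∨ (s e = b ∧ t e = a)

/-- `T` is a spanning tree of the connected multigraph `(V, E, s, t)`:
`|T| = |V| − 1` and the multigraph `(V, T)` is connected. -/
def IsSpanningTree {E V : Type*} [Fintype E] [Fintype V] (s t : E → V)
    (T : Finset E) : Prop :=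
  T.card + 1 = Fintype.card V ∧
    ∀ u v : V, Relation.ReflTransGen (EdgeStep s t T) u v

/-- The graph polynomial `Ψ_Γ = det(Σ_e A_e M_e) ∈ ℤ[A_e : e ∈ E]`, where `h` is a
`ℤ`-basis of `H₁(Γ,ℤ)` and `(M_e)_{ij} = (h_i)_e (h_j)_e`. -/
noncomputable def graphPoly {E : Type*} [Fintype E] {r : ℕ} (h : Fin r → (E → ℤ)) :
    MvPolynomial E ℤ :=
  (Matrix.of fun i j : Fin r => ∑ e : E, X e * C (h i e * h j e)).det

/-- The Cauchy–Binet formula, where `g S` enumerates the `n`-element set `S`. -/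
theorem Matrix.det_mul_eq_sum_powersetCard {R E : Type*} [CommRing R] [Fintype E] [DecidableEq E]
    {n : ℕ} (A : Matrix (Fin n) E R) (B : Matrix E (Fin n) R) (g : Finset E → Fin n → E)
    (hg : ∀ S ∈ Finset.powersetCard n (Finset.univ : Finset E),
      Function.Injective (g S) ∧ Finset.univ.image (g S) = S) :
    (A * B).det = ∑ S ∈ Finset.powersetCard n Finset.univ,
      (A.submatrix id (g S)).det * (B.submatrix (g S) id).det := by
  have expand : (A * B).det
      = ∑ f : Fin n → E, (∏ i, A i (f i)) * (B.submatrix f id).det := by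
    have key := (Matrix.detRowAlternating (R := R) (n := Fin n)).toMultilinearMap.map_sum
      (fun i (e : E) => A i e • B e)
    have hrow : (fun i => ∑ e, A i e • B e) = A * B := by
      ext i j
      simp [Matrix.mul_apply]
    rw [hrow] at key
    refine key.trans (Finset.sum_congr rfl fun f _ => ?_)
    exact (Matrix.detRowAlternating (R := R) (n := Fin n)).toMultilinearMap.map_smul_univ
      (fun i => A i (f i)) (fun i => B (f i))
  have inj_only : (A * B).det
      = ∑ f : Fin n → E with Function.Injective f, (∏ i, A i (f i)) * (B.submatrix f id).det := by
    rw [expand, Finset.sum_filter_of_ne]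
    intro f _ hf
    by_contra hninj
    obtain ⟨i, j, hij, hne⟩ : ∃ i j, f i = f j ∧ i ≠ j := by
      simpa [Function.Injective] using hninj
    refine hf ?_
    rw [Matrix.det_zero_of_row_eq hne (by ext k; simp [hij]), mul_zero]
  rw [inj_only, ← Finset.sum_fiberwise_of_maps_to (t := Finset.powersetCard n Finset.univ)
    (g := fun f => Finset.univ.image f)]
  · refine Finset.sum_congr rfl fun S hS => ?_
    obtain ⟨hinj, himage⟩ := hg S hS
    rw [← Matrix.det_transpose (A.submatrix id (g S)), Matrix.det_apply', Finset.sum_mul]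
    symm
    refine Finset.sum_bij (fun σ _ => g S ∘ σ) ?_ ?_ ?_ ?_
    · intro σ _
      simp only [Finset.mem_filter, Finset.mem_univ, true_and]
      refine ⟨hinj.comp σ.injective, ?_⟩
      conv_rhs => rw [← himage]
      ext e
      simpa using (σ.surjective.exists (p := fun k => g S k = e)).symm
    · intro σ _ τ _ hστ
      exact Equiv.ext fun i => hinj (congrFun hστ i)
    · intro f hf
      simp only [Finset.mem_filter, Finset.mem_univ, true_and] at hf
      have hmem : ∀ i, ∃ k, g S k = f i := fun i => by
        have : f i ∈ Finset.univ.image (g S) := by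
          rw [himage, ← hf.2]
          simp
        simpa using this
      choose k hk using hmem
      have hkinj : Function.Injective k := fun i j hij => hf.1 (by rw [← hk i, ← hk j, hij])
      exact ⟨Equiv.ofBijective k (Finite.injective_iff_bijective.1 hkinj), Finset.mem_univ _,
        funext hk⟩
    · intro σ _
      have hperm : B.submatrix (g S ∘ σ) id = (B.submatrix (g S) id).submatrix σ id := rfl
      rw [hperm, Matrix.det_permute]
      simp only [Matrix.transpose_apply, Matrix.submatrix_apply, id, Function.comp]
      ring
  · intro f hf
    simp only [Finset.mem_filter, Finset.mem_univ, true_and] at hf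
    simp [Finset.mem_powersetCard, Finset.card_image_of_injective _ hf]

/-- `graphBoundary` as a linear map. -/
def graphBoundaryLinear {E V : Type*} [Fintype E] [DecidableEq V] (s t : E → V) :
    (E → ℤ) →ₗ[ℤ] (V → ℤ) where
  toFun := graphBoundary s t
  map_add' f g := by
    ext v
    simp [graphBoundary, add_mul, Finset.sum_add_distrib]
  map_smul' c f := by
    ext v
    simp [graphBoundary, mul_assoc, Finset.mul_sum]

theorem graphBoundary_single {E V : Type*} [Fintype E] [DecidableEq E] [DecidableEq V]
    (s t : E → V) (e : E) :
    graphBoundary s t (Pi.single e 1) = Pi.single (s e) 1 - Pi.single (t e) 1 := by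
  ext v
  simp [graphBoundary, Pi.single_apply, eq_comm]

theorem sum_mul_graphBoundary {E V : Type*} [Fintype E] [Fintype V] [DecidableEq V]
    (s t : E → V) (f : E → ℤ) (w : V → ℤ) :
    ∑ v, w v * graphBoundary s t f v = ∑ e, f e * (w (s e) - w (t e)) := by
  simp only [graphBoundary, Finset.mul_sum]
  rw [Finset.sum_comm]
  refine Finset.sum_congr rfl fun e _ => ?_
  simp_rw [mul_left_comm (w _), ← Finset.mul_sum, mul_sub, Finset.sum_sub_distrib]
  simp [mul_sub]

theorem range_graphBoundaryLinear {E V : Type*} [Fintype E] [Fintype V] [DecidableEq V]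
    [Nonempty V] (s t : E → V)
    (hconn : ∀ u v : V, Relation.ReflTransGen (EdgeStep s t Finset.univ) u v) :
    LinearMap.range (graphBoundaryLinear s t)
      = LinearMap.ker (Fintype.linearCombination ℤ (fun _ : V => (1 : ℤ))) := by
  classical
  apply le_antisymm
  · rintro _ ⟨f, rfl⟩
    have hsum := sum_mul_graphBoundary s t f 1
    simpa [Fintype.linearCombination_apply, graphBoundaryLinear] using hsum
  · intro x hx
    have hx0 : ∑ v, x v = 0 := by
      simpa [Fintype.linearCombination_apply] using hx
    have hdiff : ∀ u v : V, (Pi.single u 1 - Pi.single v 1 : V → ℤ)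
        ∈ LinearMap.range (graphBoundaryLinear s t) := by
      intro u v
      induction hconn u v with
      | refl => simp
      | @tail b c _ hbc ih =>
        have hstep : (Pi.single b 1 - Pi.single c 1 : V → ℤ)
            ∈ LinearMap.range (graphBoundaryLinear s t) := by
          obtain ⟨e, _, ⟨rfl, rfl⟩ | ⟨rfl, rfl⟩⟩ := hbc
          · exact ⟨Pi.single e 1, graphBoundary_single s t e⟩
          · rw [← neg_sub]
            exact neg_mem ⟨Pi.single e 1, graphBoundary_single s t e⟩
        simpa using add_mem ih hstep
    obtain ⟨v₀⟩ := ‹Nonempty V›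
    have hdecomp : x = ∑ v, x v • (Pi.single v 1 - Pi.single v₀ 1 : V → ℤ) := by
      simp_rw [smul_sub, Finset.sum_sub_distrib, ← Finset.sum_smul, hx0, zero_smul, sub_zero]
      exact pi_eq_sum_univ' x
    rw [hdecomp]
    exact sum_mem fun v _ => Submodule.smul_mem _ _ (hdiff v v₀)

theorem finrank_range_add_finrank_ker_int {M N : Type*} [AddCommGroup M] [AddCommGroup N]
    [Module.Finite ℤ M] (φ : M →ₗ[ℤ] N) :
    Module.finrank ℤ (LinearMap.range φ) + Module.finrank ℤ (LinearMap.ker φ)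
      = Module.finrank ℤ M := by
  rw [← φ.quotKerEquivRange.finrank_eq, Submodule.finrank_quotient_add_finrank]

/-- The first Betti number of a connected multigraph, in subtraction-free form. -/
theorem finrank_ker_graphBoundaryLinear_add_card {E V : Type*} [Fintype E] [Fintype V]
    [DecidableEq V] [Nonempty V] (s t : E → V)
    (hconn : ∀ u v : V, Relation.ReflTransGen (EdgeStep s t Finset.univ) u v) :
    Module.finrank ℤ (LinearMap.ker (graphBoundaryLinear s t)) + Fintype.card V
      = Fintype.card E + 1 := by
  classical
  have hE := finrank_range_add_finrank_ker_int (graphBoundaryLinear s t)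
  have hV := finrank_range_add_finrank_ker_int
    (Fintype.linearCombination ℤ (fun _ : V => (1 : ℤ)))
  have htop : LinearMap.range (Fintype.linearCombination ℤ (fun _ : V => (1 : ℤ))) = ⊤ := by
    rw [LinearMap.range_eq_top]
    intro c
    obtain ⟨v⟩ := ‹Nonempty V›
    exact ⟨Pi.single v c, by simp [Fintype.linearCombination_apply]⟩
  rw [range_graphBoundaryLinear s t hconn] at hE
  rw [htop, finrank_top] at hV
  simp only [Module.finrank_fintype_fun_eq_card, Module.finrank_self] at hE hV
  omega

theorem reflTransGen_edgeStep_of_injective {E V : Type*} [Fintype E] [Fintype V]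
    [DecidableEq V] (s t : E → V)
    (hinj : Function.Injective (graphBoundaryLinear s t))
    (hcard : Fintype.card E + 1 = Fintype.card V) (u v : V) :
    Relation.ReflTransGen (EdgeStep s t Finset.univ) u v := by
  classical
  by_contra huv
  set C : V → Prop := Relation.ReflTransGen (EdgeStep s t Finset.univ) u
  have hCu : C u := Relation.ReflTransGen.refl
  have hCe : ∀ e, C (s e) ↔ C (t e) := fun e =>
    ⟨fun hs => hs.tail ⟨e, Finset.mem_univ e, Or.inl ⟨rfl, rfl⟩⟩,
      fun ht => ht.tail ⟨e, Finset.mem_univ e, Or.inr ⟨rfl, rfl⟩⟩⟩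
  let w : V → ℤ × ℤ := fun x => if C x then (1, 0) else (0, 1)
  let φ : (V → ℤ) →ₗ[ℤ] ℤ × ℤ := Fintype.linearCombination ℤ w
  have hφ : ∀ x c, φ (Pi.single x c) = c • w x := fun x c =>
    Fintype.linearCombination_apply_single ℤ w x c
  have htop : LinearMap.range φ = ⊤ := by
    rw [LinearMap.range_eq_top]
    rintro ⟨a, b⟩
    refine ⟨Pi.single u a + Pi.single v b, ?_⟩
    rw [map_add, hφ, hφ]
    simp [w, hCu, huv]
  have hle : LinearMap.range (graphBoundaryLinear s t) ≤ LinearMap.ker φ := by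
    rw [LinearMap.range_le_ker_iff]
    refine LinearMap.pi_ext' fun e => LinearMap.ext_ring ?_
    change φ (graphBoundary s t (Pi.single e 1)) = 0
    rw [graphBoundary_single, map_sub, hφ, hφ]
    simp [w, hCe e]
  have hE := LinearMap.finrank_range_of_inj hinj
  have hV := finrank_range_add_finrank_ker_int φ
  have hmono := Submodule.finrank_mono hle
  rw [htop, finrank_top] at hV
  simp only [Module.finrank_fintype_fun_eq_card, Module.finrank_self, Module.finrank_prod] at hE hV
  omega

theorem edgeStep_subtype_univ {E V : Type*} [Fintype E] (s t : E → V) (T : Finset E) :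
    EdgeStep (fun e : T => s e) (fun e : T => t e) Finset.univ = EdgeStep s t T := by
  ext a b
  simp [EdgeStep]

/-- Extension by zero of a chain supported on `T` commutes with the boundary. -/
theorem graphBoundary_extend {E V : Type*} [Fintype E] [DecidableEq E] [DecidableEq V]
    (s t : E → V) (T : Finset E) (f : T → ℤ) :
    graphBoundary s t (fun e => if he : e ∈ T then f ⟨e, he⟩ else 0)
      = graphBoundary (fun e : T => s e) (fun e : T => t e) f := by
  ext v
  simp only [graphBoundary]
  rw [← Finset.sum_subset (Finset.subset_univ T) (fun e _ he => by simp [he]),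
    ← Finset.sum_coe_sort T]
  simp

theorem exists_sum_of_graphBoundary_eq_zero {E V : Type*} [Fintype E] [DecidableEq V]
    {s t : E → V} {r : ℕ} {h : Fin r → (E → ℤ)}
    (hspan : ∀ f : E → ℤ, graphBoundary s t f = 0 → f ∈ Submodule.span ℤ (Set.range h))
    {f : E → ℤ} (hf : graphBoundary s t f = 0) :
    ∃ a : Fin r → ℤ, ∀ e, f e = ∑ i, a i * h i e := by
  obtain ⟨a, ha⟩ := (Submodule.mem_span_range_iff_exists_fun ℤ).1 (hspan f hf)
  exact ⟨a, fun e => by simp [← ha]⟩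

theorem isUnit_det_of_connected {E V : Type*} [Fintype E] [Fintype V] [DecidableEq E]
    [DecidableEq V] [Nonempty V] {s t : E → V} {r : ℕ} {h : Fin r → (E → ℤ)}
    (hspan : ∀ f : E → ℤ, graphBoundary s t f = 0 → f ∈ Submodule.span ℤ (Set.range h))
    {g : Fin r → E} (hg : Function.Injective g) {T : Finset E} (hgT : ∀ j, g j ∉ T)
    (hT : ∀ u v : V, Relation.ReflTransGen (EdgeStep s t T) u v) :
    IsUnit (Matrix.of fun i j => h i (g j)).det := by
  have hcycle : ∀ j, ∃ a : Fin r → ℤ, ∀ k, ∑ i, a i * h i (g k) = if j = k then 1 else 0 := by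
    intro j
    have hmem : graphBoundary s t (Pi.single (g j) 1)
        ∈ LinearMap.range (graphBoundaryLinear (fun e : T => s e) (fun e : T => t e)) := by
      rw [range_graphBoundaryLinear _ _ (by rwa [edgeStep_subtype_univ]), graphBoundary_single]
      simp [Fintype.linearCombination_apply]
    obtain ⟨f, hf⟩ := hmem
    have hf' := (graphBoundary_extend s t T f).trans hf
    have hzero : graphBoundary s t
        (Pi.single (g j) 1 - fun e => if he : e ∈ T then f ⟨e, he⟩ else 0) = 0 := by
      change graphBoundaryLinear s t _ = 0
      rw [map_sub, sub_eq_zero]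
      exact hf'.symm
    obtain ⟨a, ha⟩ := exists_sum_of_graphBoundary_eq_zero hspan hzero
    refine ⟨a, fun k => ?_⟩
    rw [← ha]
    simp [hgT k, Pi.single_apply, hg.eq_iff, eq_comm]
  choose a ha using hcycle
  refine Matrix.isUnit_det_of_left_inverse (B := Matrix.of a) ?_
  ext j k
  simp [Matrix.mul_apply, ha, Matrix.one_apply]

theorem injective_graphBoundaryLinear_of_det_ne_zero {E V : Type*} [Fintype E] [DecidableEq E]
    [DecidableEq V] {s t : E → V} {r : ℕ} {h : Fin r → (E → ℤ)}
    (hspan : ∀ f : E → ℤ, graphBoundary s t f = 0 → f ∈ Submodule.span ℤ (Set.range h))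
    {g : Fin r → E} {T : Finset E} (hgT : ∀ j, g j ∉ T)
    (hdet : (Matrix.of fun i j => h i (g j)).det ≠ 0) :
    Function.Injective (graphBoundaryLinear (fun e : T => s e) (fun e : T => t e)) := by
  rw [injective_iff_map_eq_zero]
  intro f hf
  obtain ⟨a, ha⟩ := exists_sum_of_graphBoundary_eq_zero hspan
    ((graphBoundary_extend s t T f).trans hf)
  have ha0 : a = 0 := by
    refine Matrix.eq_zero_of_vecMul_eq_zero hdet (funext fun k => ?_)
    simpa [hgT k, Matrix.vecMul, dotProduct] using (ha (g k)).symm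
  ext e
  simpa [ha0] using ha e

theorem finrank_ker_graphBoundaryLinear_of_basis {E V : Type*} [Fintype E] [DecidableEq V]
    {s t : E → V} {r : ℕ} {h : Fin r → (E → ℤ)}
    (hker : ∀ i, graphBoundary s t (h i) = 0)
    (hspan : ∀ f : E → ℤ, graphBoundary s t f = 0 → f ∈ Submodule.span ℤ (Set.range h))
    (hindep : LinearIndependent ℤ h) :
    Module.finrank ℤ (LinearMap.ker (graphBoundaryLinear s t)) = r := by
  have heq : LinearMap.ker (graphBoundaryLinear s t) = Submodule.span ℤ (Set.range h) := by
    refine le_antisymm (fun f hf => hspan f hf) (Submodule.span_le.2 ?_)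
    rintro _ ⟨i, rfl⟩
    exact hker i
  rw [heq, finrank_span_eq_card hindep, Fintype.card_fin]

theorem graphPoly_eq_det_mul {E : Type*} [Fintype E] {r : ℕ} (h : Fin r → (E → ℤ)) :
    graphPoly h = (((Matrix.of fun i e => X e * C (h i e)) : Matrix (Fin r) E (MvPolynomial E ℤ)) *
      ((Matrix.of fun e j => C (h j e)) : Matrix E (Fin r) (MvPolynomial E ℤ))).det := by
  rw [graphPoly]
  congr 1
  ext1 i j
  simp [Matrix.mul_apply, mul_assoc]

/-- The expansion of the graph polynomial in maximal minors, where `g S` enumerates `S`. -/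
theorem graphPoly_eq_sum_minors {E : Type*} [Fintype E] [DecidableEq E] {r : ℕ}
    (h : Fin r → (E → ℤ)) (g : Finset E → Fin r → E)
    (hg : ∀ S ∈ Finset.powersetCard r (Finset.univ : Finset E),
      Function.Injective (g S) ∧ Finset.univ.image (g S) = S) :
    graphPoly h = ∑ S ∈ Finset.powersetCard r Finset.univ,
      C ((Matrix.of fun i j => h i (g S j)).det ^ 2) * ∏ e ∈ S, (X e : MvPolynomial E ℤ) := by
  rw [graphPoly_eq_det_mul, Matrix.det_mul_eq_sum_powersetCard _ _ g hg]
  refine Finset.sum_congr rfl fun S hS => ?_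
  obtain ⟨hinj, himage⟩ := hg S hS
  have hleft : ((Matrix.of fun i e => (X e : MvPolynomial E ℤ) * C (h i e)).submatrix id
      (g S)).det = (∏ e ∈ S, X e) * C (Matrix.of fun i j => h i (g S j)).det := by
    have hprod : ∏ e ∈ S, (X e : MvPolynomial E ℤ) = ∏ j, X (g S j) := by
      rw [← Finset.prod_image (f := X) hinj.injOn, himage]
    rw [hprod, RingHom.map_det]
    exact Matrix.det_mul_row (fun j => X (g S j)) _
  have hright : ((Matrix.of fun e j => (C (h j e) : MvPolynomial E ℤ)).submatrix (g S) id).det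
      = C (Matrix.of fun i j => h i (g S j)).det := by
    rw [RingHom.map_det, ← Matrix.det_transpose]
    rfl
  rw [hleft, hright, map_pow]
  ring

open scoped Classical in
/-- Proposition 2.3: for a finite connected directed multigraph `Γ` and a `ℤ`-basis
`h₁,…,h_r` of `H₁(Γ,ℤ) = ker ∂`, the graph polynomial is the spanning-tree sum:
`Ψ_Γ = Σ_{T spanning tree} Π_{e ∉ T} A_e`. -/
theorem graphPoly_eq_spanningTree_sum {E V : Type*}
    [Fintype E] [Fintype V] [DecidableEq E] [DecidableEq V] [Nonempty V]
    (s t : E → V)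
    (hconn : ∀ u v : V, Relation.ReflTransGen (EdgeStep s t Finset.univ) u v)
    (r : ℕ) (h : Fin r → (E → ℤ))
    (hker : ∀ i, graphBoundary s t (h i) = 0)
    (hspan : ∀ f : E → ℤ, graphBoundary s t f = 0 →
      f ∈ Submodule.span ℤ (Set.range h))
    (hindep : LinearIndependent ℤ h) :
    graphPoly h
      = ∑ T : Finset E, if IsSpanningTree s t T then ∏ e ∈ Tᶜ, (X e : MvPolynomial E ℤ)
          else 0 := by
  classical
  have hr := finrank_ker_graphBoundaryLinear_add_card s t hconn
  rw [finrank_ker_graphBoundaryLinear_of_basis hker hspan hindep] at hr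
  obtain ⟨d⟩ : Nonempty (Fin r ↪ E) := Function.Embedding.nonempty_of_card_le (by
    have := Fintype.card_pos (α := V)
    rw [Fintype.card_fin]
    omega)
  have henum : ∀ S : Finset E, ∃ g : Fin r → E,
      S ∈ Finset.powersetCard r (Finset.univ : Finset E) →
        Function.Injective g ∧ Finset.univ.image g = S := by
    intro S
    by_cases hS : S ∈ Finset.powersetCard r (Finset.univ : Finset E)
    · let φ := S.equivFinOfCardEq (Finset.mem_powersetCard.1 hS).2
      refine ⟨fun i => φ.symm i, fun _ =>
        ⟨Subtype.val_injective.comp φ.symm.injective, ?_⟩⟩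
      ext e
      simp [← φ.symm.surjective.exists (p := fun x : S => (x : E) = e)]
    · exact ⟨d, fun hS' => absurd hS' hS⟩
  choose g hg using henum
  have hgT : ∀ S ∈ Finset.powersetCard r Finset.univ, ∀ j, g S j ∉ Sᶜ := fun S hS j => by
    rw [Finset.mem_compl, not_not, ← Finset.ext_iff.1 (hg S hS).2]
    exact Finset.mem_image_of_mem _ (Finset.mem_univ j)
  rw [graphPoly_eq_sum_minors h g hg, ← Finset.sum_filter,
    ← Finset.sum_filter_of_ne (p := fun S => IsSpanningTree s t Sᶜ)]
  · refine Finset.sum_bij (fun S _ => Sᶜ) ?_ ?_ ?_ ?_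
    · intro S hS
      simpa using (Finset.mem_filter.1 hS).2
    · intro S _ S' _ hSS'
      exact compl_injective hSS'
    · intro T hT
      have hT' := (Finset.mem_filter.1 hT).2
      have hcompl := Finset.card_add_card_compl T
      have := hT'.1
      refine ⟨Tᶜ, ?_, compl_compl T⟩
      rw [Finset.mem_filter, Finset.mem_powersetCard, compl_compl]
      exact ⟨⟨Finset.subset_univ _, by omega⟩, hT'⟩
    · intro S hS
      obtain ⟨hSr, hT⟩ := Finset.mem_filter.1 hS
      rw [sq, Int.isUnit_mul_self (isUnit_det_of_connected hspan (hg S hSr).1 (hgT S hSr) hT.2),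
        map_one, one_mul, compl_compl]
  · intro S hSr hne
    have hdet : (Matrix.of fun i j => h i (g S j)).det ≠ 0 := fun hzero =>
      hne (by simp [hzero])
    have hcompl := Finset.card_add_card_compl S
    have hcard : Sᶜ.card + 1 = Fintype.card V := by
      have := (Finset.mem_powersetCard.1 hSr).2
      omega
    refine ⟨hcard, ?_⟩
    rw [← edgeStep_subtype_univ]
    exact reflTransGen_edgeStep_of_injective _ _
      (injective_graphBoundaryLinear_of_det_ne_zero hspan (hgT S hSr) hdet) (by rwa [Fintype.card_coe])
end

section
/- For every t ≥ 1 and all positive integers l₁,…,l_t with l₁ ≥ 2 and l_t ≥ 2, the generalized zigzag graph GZZ(l₁,…,l_t) is primitively log divergent. In particular, setting n = 1 + l₁ + ⋯ + l_t, it has n+1 vertices, 2n edges and first Betti number h₁ = n. -/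
/-- The first Betti number `h₁(G) = |E(G)| − |V(G)| + c(G)` of a finite simple graph. -/
noncomputable def betti {V : Type*} (G : SimpleGraph V) : ℤ :=
  (Nat.card G.edgeSet : ℤ) - (Nat.card V : ℤ) + (Nat.card G.ConnectedComponent : ℤ)

/-- The set of endpoints of the edges in `F`. -/
def edgeSupport {V : Type*} (F : Set (Sym2 V)) : Set V := {v : V | ∃ e ∈ F, v ∈ e}

/-- The subgraph spanned by a set of edges `F`: its edge set is `F` and its vertex set
is the set of endpoints of edges in `F`. -/
def spannedSubgraph {V : Type*} (F : Set (Sym2 V)) : SimpleGraph (edgeSupport F) :=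
  (SimpleGraph.fromEdgeSet F).induce (edgeSupport F)

/-- `h₁(G_F) = |F| − |V(G_F)| + c(G_F)` for the subgraph spanned by `F`. -/
noncomputable def bettiOfEdges {V : Type*} (F : Set (Sym2 V)) : ℤ :=
  (Nat.card F : ℤ) - (Nat.card (edgeSupport F) : ℤ)
    + (Nat.card (spannedSubgraph F).ConnectedComponent : ℤ)

/-- The subgraph spanned by `F` is convergent: `|E| > 2·h₁`. -/
def ConvergentEdges {V : Type*} (F : Set (Sym2 V)) : Prop :=
  2 * bettiOfEdges F < (Nat.card F : ℤ)

/-- A graph is logarithmically divergent if `|E(G)| = 2·h₁(G)`. -/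
def LogDivergent {V : Type*} (G : SimpleGraph V) : Prop :=
  (Nat.card G.edgeSet : ℤ) = 2 * betti G

/-- A graph is primitively log divergent if it is logarithmically divergent and the
subgraph spanned by every nonempty proper subset of its edges which is connected is
convergent. -/
def PrimLogDivergent {V : Type*} (G : SimpleGraph V) : Prop :=
  LogDivergent G ∧
    ∀ F : Set (Sym2 V), F ⊆ G.edgeSet → F.Nonempty → F ≠ G.edgeSet →
      (spannedSubgraph F).Connected → ConvergentEdges F

/-- The vertex type of the generalized zigzag graph `GZZ(l₁,…,l_t)` (0-indexed):
`Sum.inl k` is the vertex `u_{k+1}` (for `k : Fin (t+2)`), and `Sum.inr ⟨i, j⟩` is the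
vertex `v_{i+1, j+1}` (for `i : Fin t` and `j : Fin (l_{i+1} − 1)`). -/
abbrev GzzV (t : ℕ) (l : Fin t → ℕ) : Type :=
  Fin (t+2) ⊕ (Σ i : Fin t, Fin (l i - 1))

/-- The `j`-th vertex on the path `u_{i+1}, v_{i+1,1}, …, v_{i+1,l_{i+1}−1}, u_{i+3}`
(0-indexed: `w 0 = u_{i+1}`, `w j = v_{i+1,j}` for `0 < j < l_{i+1}`, and
`w (l_{i+1}) = u_{i+3}`). -/
def gzzPathVert {t : ℕ} (l : Fin t → ℕ) (i : Fin t) (j : ℕ) : GzzV t l :=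
  if h0 : j = 0 then Sum.inl ⟨(i : ℕ), by have := i.isLt; omega⟩
  else if h : j < l i then Sum.inr ⟨i, ⟨j - 1, by omega⟩⟩
  else Sum.inl ⟨(i : ℕ) + 2, by have := i.isLt; omega⟩

/-- The edge set of the generalized zigzag graph `GZZ(l₁,…,l_t)`: the path edges
`u_i u_{i+1}`, the edges of the paths `u_i, v_{i,1}, …, v_{i,l_i−1}, u_{i+2}`, the
edges `v_{i,j} u_{i+1}`, and the closing edge `u₁ u_{t+2}`. -/
def gzzEdges (t : ℕ) (l : Fin t → ℕ) : Set (Sym2 (GzzV t l)) :=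
  {e : Sym2 (GzzV t l) |
    (∃ i : Fin (t+1), e = s(Sum.inl i.castSucc, Sum.inl i.succ)) ∨
    (∃ i : Fin t, ∃ j : ℕ, j < l i ∧ e = s(gzzPathVert l i j, gzzPathVert l i (j+1))) ∨
    (∃ i : Fin t, ∃ jj : Fin (l i - 1),
      e = s(Sum.inr ⟨i, jj⟩, Sum.inl ⟨(i : ℕ) + 1, by have := i.isLt; omega⟩)) ∨
    e = s(Sum.inl 0, Sum.inl (Fin.last (t+1)))}

/-- The generalized zigzag graph `GZZ(l₁,…,l_t)`. -/
def gzz (t : ℕ) (l : Fin t → ℕ) : SimpleGraph (GzzV t l) :=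
  SimpleGraph.fromEdgeSet (gzzEdges t l)

/-- The numbers `f k` and `g k` are two distinct predecessors of each `2 ≤ k ≤ n`, one of them
is `k - 1`, and only `k = 2` has the predecessor `0`; moreover `f 1 = 0`. -/
structure IsBackPair (n : ℕ) (f g : ℕ → ℕ) : Prop where
  one : f 1 = 0
  left_lt : ∀ k, 2 ≤ k → k ≤ n → f k < k
  right_lt : ∀ k, 2 ≤ k → k ≤ n → g k < k
  ne : ∀ k, 2 ≤ k → k ≤ n → f k ≠ g k
  pred : ∀ k, 2 ≤ k → k ≤ n → f k = k - 1 ∨ g k = k - 1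
  left_pos : ∀ k, 3 ≤ k → k ≤ n → 1 ≤ f k
  right_pos : ∀ k, 3 ≤ k → k ≤ n → 1 ≤ g k

/-- The edges joining each `k ≤ n` to its predecessors, together with the edge `{0, n}`. -/
def backEdges (n : ℕ) (f g : ℕ → ℕ) : Finset (Sym2 ℕ) :=
  (Finset.Icc 1 n).image (fun k => s(k, f k)) ∪ (Finset.Icc 2 n).image (fun k => s(k, g k)) ∪
    {s(0, n)}

theorem mem_backEdges {n : ℕ} {f g : ℕ → ℕ} {e : Sym2 ℕ} :
    e ∈ backEdges n f g ↔ (∃ k, 1 ≤ k ∧ k ≤ n ∧ e = s(k, f k)) ∨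
      (∃ k, 2 ≤ k ∧ k ≤ n ∧ e = s(k, g k)) ∨ e = s(0, n) := by
  simp only [backEdges, Finset.mem_union, Finset.mem_image, Finset.mem_Icc, Finset.mem_singleton,
    and_assoc, or_assoc, eq_comm (a := e)]

namespace IsBackPair

variable {n : ℕ} {f g : ℕ → ℕ}

theorem left_lt' (h : IsBackPair n f g) {k : ℕ} (hk : 1 ≤ k) (hkn : k ≤ n) : f k < k := by
  rcases hk.eq_or_lt with rfl | hk
  · simp [h.one]
  · exact h.left_lt k hk hkn

theorem not_isDiag (h : IsBackPair n f g) (hn : 3 ≤ n) {e : Sym2 ℕ} (he : e ∈ backEdges n f g) :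
    ¬ e.IsDiag := by
  rcases mem_backEdges.1 he with ⟨k, h1, h2, rfl⟩ | ⟨k, h1, h2, rfl⟩ | rfl
  · have := h.left_lt' h1 h2
    simp only [Sym2.mk_isDiag_iff]; omega
  · have := h.right_lt k h1 h2
    simp only [Sym2.mk_isDiag_iff]; omega
  · simp only [Sym2.mk_isDiag_iff]; omega

theorem card_backEdges (h : IsBackPair n f g) (hn : 3 ≤ n) : (backEdges n f g).card = 2 * n := by
  rw [backEdges, Finset.card_union_of_disjoint, Finset.card_union_of_disjoint,
    Finset.card_image_of_injOn, Finset.card_image_of_injOn]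
  · simp only [Nat.card_Icc, Finset.card_singleton]; omega
  · intro a ha b hb hab
    simp only [Finset.coe_Icc, Set.mem_Icc] at ha hb
    have := h.right_lt a ha.1 ha.2
    have := h.right_lt b hb.1 hb.2
    simp only [Sym2.eq_iff] at hab
    omega
  · intro a ha b hb hab
    simp only [Finset.coe_Icc, Set.mem_Icc] at ha hb
    have := h.left_lt' ha.1 ha.2
    have := h.left_lt' hb.1 hb.2
    simp only [Sym2.eq_iff] at hab
    omega
  · rw [Finset.disjoint_left]
    simp only [Finset.mem_image, Finset.mem_Icc, not_exists, not_and]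
    rintro _ ⟨a, ha, rfl⟩ b hb hab
    have := h.left_lt' ha.1 ha.2
    have := h.right_lt b hb.1 hb.2
    have := h.ne b hb.1 hb.2
    rw [Sym2.eq_iff] at hab
    rcases hab with ⟨rfl, h'⟩ | h' <;> omega
  · rw [Finset.disjoint_singleton_right]
    simp only [Finset.mem_union, Finset.mem_image, Finset.mem_Icc, not_or, not_exists, not_and]
    have := h.left_pos n hn le_rfl
    have := h.right_pos n hn le_rfl
    refine ⟨fun k hk h' => ?_, fun k hk h' => ?_⟩ <;>
      rcases Sym2.eq_iff.1 h' with ⟨rfl, h''⟩ | ⟨rfl, h''⟩ <;> omega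

/-- The number of edges inside a proper subset `S` of the vertices is at most `2 |S| - 3`. -/
theorem count_le (h : IsBackPair n f g) (hn : 3 ≤ n) {S : Finset ℕ}
    (hS : S ⊆ Finset.range (n + 1)) (hne : S ≠ Finset.range (n + 1)) (hcard : 2 ≤ S.card) :
    (S.filter fun k => 1 ≤ k ∧ f k ∈ S).card + (S.filter fun k => 2 ≤ k ∧ g k ∈ S).card +
      (if 0 ∈ S ∧ n ∈ S then 1 else 0) + 3 ≤ 2 * S.card := by
  set A := S.filter fun k => 1 ≤ k ∧ f k ∈ S with hA
  set B := S.filter fun k => 2 ≤ k ∧ g k ∈ S with hB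
  have memA : ∀ k, k ∈ A ↔ k ∈ S ∧ 1 ≤ k ∧ f k ∈ S := fun k => by simp [hA]
  have memB : ∀ k, k ∈ B ↔ k ∈ S ∧ 2 ≤ k ∧ g k ∈ S := fun k => by simp [hB]
  clear_value A B
  clear hA hB
  have le_n : ∀ k ∈ S, k ≤ n := fun k hk => by simpa [Nat.lt_succ_iff] using hS hk
  have hAB := Finset.card_union_add_card_inter A B
  have union_le : ∀ X ⊆ S, (∀ k ∈ X, k ∉ A ∧ k ∉ B) → (A ∪ B).card + X.card ≤ S.card := by
    intro X hX hXAB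
    rw [← Finset.card_union_of_disjoint]
    · refine Finset.card_le_card (Finset.union_subset (Finset.union_subset ?_ ?_) hX)
      · exact fun k hk => ((memA k).1 hk).1
      · exact fun k hk => ((memB k).1 hk).1
    · rw [Finset.disjoint_right]
      exact fun k hk hk' => (Finset.mem_union.1 hk').elim (hXAB k hk).1 (hXAB k hk).2
  have inter_le : ∀ X ⊆ S, (∀ k ∈ X, k ∉ A ∨ k ∉ B) → (A ∩ B).card + X.card ≤ S.card := by
    intro X hX hXAB
    rw [← Finset.card_union_of_disjoint]
    · refine Finset.card_le_card (Finset.union_subset ?_ hX)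
      exact fun k hk => ((memA k).1 (Finset.mem_inter.1 hk).1).1
    · rw [Finset.disjoint_right]
      exact fun k hk hk' => (hXAB k hk).elim (fun h' => h' (Finset.mem_inter.1 hk').1)
        (fun h' => h' (Finset.mem_inter.1 hk').2)
  have hSne : S.Nonempty := Finset.card_pos.1 (by omega)
  obtain ⟨m, hm, hmin⟩ : ∃ m ∈ S, ∀ k ∈ S, m ≤ k :=
    ⟨S.min' hSne, S.min'_mem _, fun k hk => S.min'_le k hk⟩
  have hSne' : (S.erase m).Nonempty := Finset.card_pos.1 (by rw [Finset.card_erase_of_mem hm]; omega)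
  obtain ⟨s, hs, hsmin⟩ : ∃ s ∈ S.erase m, ∀ k ∈ S.erase m, s ≤ k :=
    ⟨_, (S.erase m).min'_mem hSne', fun k hk => (S.erase m).min'_le k hk⟩
  have hsS : s ∈ S := Finset.mem_of_mem_erase hs
  have hsm : s ≠ m := Finset.ne_of_mem_erase hs
  have hms : m < s := lt_of_le_of_ne (hmin s hsS) hsm.symm
  have lt_s : ∀ k ∈ S, k < s → k = m := fun k hk hks => by
    by_contra hkm
    have := hsmin k (Finset.mem_erase.2 ⟨hkm, hk⟩)
    omega
  have m_notMem : m ∉ A ∧ m ∉ B := by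
    refine ⟨fun hmA => ?_, fun hmB => ?_⟩
    · obtain ⟨-, h1, h2⟩ := (memA m).1 hmA
      have := h.left_lt' h1 (le_n m hm)
      have := hmin _ h2
      omega
    · obtain ⟨-, h1, h2⟩ := (memB m).1 hmB
      have := h.right_lt m h1 (le_n m hm)
      have := hmin _ h2
      omega
  have s_notMem : s ∉ A ∨ s ∉ B := by
    by_contra hcon
    push Not at hcon
    obtain ⟨-, -, h2⟩ := (memA s).1 hcon.1
    obtain ⟨-, h3, h4⟩ := (memB s).1 hcon.2
    have hsn := le_n s hsS
    exact h.ne s h3 hsn ((lt_s _ h2 (h.left_lt s h3 hsn)).trans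
      (lt_s _ h4 (h.right_lt s h3 hsn)).symm)
  have hU := union_le {m} (by simpa using hm) (by simpa using m_notMem)
  have hI := inter_le {m, s} (by simp [Finset.insert_subset_iff, hm, hsS]) (by
    simpa [-not_and, m_notMem.1] using s_notMem)
  rw [Finset.card_singleton] at hU
  rw [Finset.card_pair hsm.symm] at hI
  split_ifs with h0
  swap
  · omega
  obtain ⟨h0, hnS⟩ := h0
  obtain rfl : m = 0 := Nat.le_zero.1 (hmin 0 h0)
  have hTne : (Finset.range (n + 1) \ S).Nonempty := by
    rw [Finset.sdiff_nonempty]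
    exact fun h' => hne (hS.antisymm h')
  obtain ⟨y, hy, hymax⟩ : ∃ y ∈ Finset.range (n + 1) \ S, ∀ k ∈ Finset.range (n + 1) \ S, k ≤ y :=
    ⟨_, Finset.max'_mem _ hTne, fun k hk => Finset.le_max' _ k hk⟩
  simp only [Finset.mem_sdiff, Finset.mem_range] at hy hymax
  obtain ⟨hyn, hyS⟩ := hy
  have hyn' : y ≠ n := fun h' => hyS (h' ▸ hnS)
  have hy0 : y ≠ 0 := fun h' => hyS (h' ▸ h0)
  have above : ∀ k, y < k → k ≤ n → k ∈ S := fun k hyk hkn => by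
    by_contra hk
    have := hymax k ⟨by omega, hk⟩
    omega
  have succ_notMem : ∀ k, 2 ≤ k → k ≤ n → k - 1 ∉ S → k ∉ A ∨ k ∉ B := by
    intro k hk hkn hkS
    rcases h.pred k hk hkn with h' | h'
    · exact Or.inl fun hkA => hkS (h' ▸ ((memA k).1 hkA).2.2)
    · exact Or.inr fun hkB => hkS (h' ▸ ((memB k).1 hkB).2.2)
  have hz := succ_notMem (y + 1) (by omega) (by omega) (by simpa using hyS)
  have hzS := above (y + 1) (by omega) (by omega)
  have inter_triple : ∀ a ∈ S, a ≠ 0 → a ≠ s → (a ∉ A ∨ a ∉ B) → (A ∩ B).card + 3 ≤ S.card := by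
    intro a ha ha0 has haAB
    have := inter_le {0, s, a} (by simp [Finset.insert_subset_iff, hm, hsS, ha]) (by
      simpa [-not_and, m_notMem.1] using ⟨s_notMem, haAB⟩)
    rwa [Finset.card_eq_three.2 ⟨0, s, a, hsm.symm, ha0.symm, has.symm, rfl⟩] at this
  by_cases hsy : y + 1 = s
  · by_cases hs3 : 3 ≤ s
    · have hsn := le_n s hsS
      have := union_le {0, s} (by simp [Finset.insert_subset_iff, hm, hsS]) (by
        have h1 := h.left_pos s hs3 hsn
        have h2 := h.right_pos s hs3 hsn
        have h3 := h.left_lt s (by omega) hsn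
        have h4 := h.right_lt s (by omega) hsn
        have h5 : s ∉ A := fun hsA => by
          have := lt_s _ ((memA s).1 hsA).2.2 h3
          omega
        have h6 : s ∉ B := fun hsB => by
          have := lt_s _ ((memB s).1 hsB).2.2 h4
          omega
        simpa [m_notMem.1, m_notMem.2] using ⟨h5, h6⟩)
      rw [Finset.card_pair hsm.symm] at this
      omega
    · have hy1 : y = 1 := by omega
      have h3 : 3 ∉ A ∨ 3 ∉ B := by
        by_contra hcon
        push Not at hcon
        have h1 := ((memA 3).1 hcon.1).2.2
        have h2 := ((memB 3).1 hcon.2).2.2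
        have h3 := h.left_lt 3 (by omega) hn
        have h4 := h.right_lt 3 (by omega) hn
        have h5 := h.left_pos 3 le_rfl hn
        have h6 := h.right_pos 3 le_rfl hn
        have h7 := h.ne 3 (by omega) hn
        have h8 : f 3 ≠ 1 := fun h' => hyS (by rw [hy1, ← h']; exact h1)
        have h9 : g 3 ≠ 1 := fun h' => hyS (by rw [hy1, ← h']; exact h2)
        omega
      have := inter_triple 3 (above 3 (by omega) hn) (by omega) (by omega) h3
      omega
  · have := inter_triple (y + 1) hzS (by omega) hsy hz
    omega

/-- A nonempty proper subset of the edges that spans the vertex set `S` has at most `2 |S| - 3`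
elements. -/
theorem card_add_three_le (h : IsBackPair n f g) (hn : 3 ≤ n) {F : Finset (Sym2 ℕ)}
    {S : Finset ℕ} (hF : F ⊂ backEdges n f g) (hFne : F.Nonempty)
    (hS : ∀ k, k ∈ S ↔ ∃ e ∈ F, k ∈ e) : F.card + 3 ≤ 2 * S.card := by
  have hSn : S ⊆ Finset.range (n + 1) := by
    intro k hk
    obtain ⟨e, he, hke⟩ := (hS k).1 hk
    rw [Finset.mem_range, Nat.lt_succ_iff]
    rcases mem_backEdges.1 (hF.1 he) with ⟨a, h1, h2, rfl⟩ | ⟨a, h1, h2, rfl⟩ | rfl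
    · have := h.left_lt' h1 h2
      rcases Sym2.mem_iff.1 hke with rfl | rfl <;> omega
    · have := h.right_lt a h1 h2
      rcases Sym2.mem_iff.1 hke with rfl | rfl <;> omega
    · rcases Sym2.mem_iff.1 hke with rfl | rfl <;> omega
  by_cases hne : S = Finset.range (n + 1)
  · have := Finset.card_lt_card hF
    rw [h.card_backEdges hn] at this
    rw [hne, Finset.card_range]
    omega
  have hcard : 2 ≤ S.card := by
    obtain ⟨e, he⟩ := hFne
    induction e with | _ a b => ?_
    have hab : a ≠ b := h.not_isDiag hn (hF.1 he)
    exact Finset.one_lt_card.2 ⟨a, (hS a).2 ⟨_, he, by simp⟩, b, (hS b).2 ⟨_, he, by simp⟩, hab⟩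
  have hsub : F ⊆ (S.filter fun k => 1 ≤ k ∧ f k ∈ S).image (fun k => s(k, f k)) ∪
      (S.filter fun k => 2 ≤ k ∧ g k ∈ S).image (fun k => s(k, g k)) ∪
      (if 0 ∈ S ∧ n ∈ S then {s(0, n)} else ∅) := by
    intro e he
    simp only [Finset.mem_union, Finset.mem_image, Finset.mem_filter]
    rcases mem_backEdges.1 (hF.1 he) with ⟨a, h1, h2, rfl⟩ | ⟨a, h1, h2, rfl⟩ | rfl
    · exact Or.inl (Or.inl ⟨a, ⟨(hS a).2 ⟨_, he, by simp⟩, h1, (hS _).2 ⟨_, he, by simp⟩⟩, rfl⟩)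
    · exact Or.inl (Or.inr ⟨a, ⟨(hS a).2 ⟨_, he, by simp⟩, h1, (hS _).2 ⟨_, he, by simp⟩⟩, rfl⟩)
    · have h0 : 0 ∈ S ∧ n ∈ S := ⟨(hS _).2 ⟨_, he, by simp⟩, (hS _).2 ⟨_, he, by simp⟩⟩
      simp [h0]
  have h1 := h.count_le hn hSn hne hcard
  have h2 := Finset.card_le_card hsub
  have h3 := (Finset.card_union_le _ _).trans (add_le_add_left (Finset.card_union_le
    ((S.filter fun k => 1 ≤ k ∧ f k ∈ S).image (fun k => s(k, f k)))
    ((S.filter fun k => 2 ≤ k ∧ g k ∈ S).image (fun k => s(k, g k))))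
    (if 0 ∈ S ∧ n ∈ S then {s(0, n)} else ∅ : Finset (Sym2 ℕ)).card)
  have h4 := Finset.card_image_le (s := S.filter fun k => 1 ≤ k ∧ f k ∈ S) (f := fun k => s(k, f k))
  have h5 := Finset.card_image_le (s := S.filter fun k => 2 ≤ k ∧ g k ∈ S) (f := fun k => s(k, g k))
  have h6 : (if 0 ∈ S ∧ n ∈ S then {s(0, n)} else ∅ : Finset (Sym2 ℕ)).card =
      if 0 ∈ S ∧ n ∈ S then 1 else 0 := by
    split_ifs <;> simp
  omega

end IsBackPair

theorem SimpleGraph.Connected.natCard_connectedComponent {V : Type*} {G : SimpleGraph V}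
    (h : G.Connected) : Nat.card G.ConnectedComponent = 1 :=
  have := h.preconnected.subsingleton_connectedComponent
  have : Nonempty G.ConnectedComponent := h.nonempty.map G.connectedComponentMk
  Nat.card_eq_one_iff_unique.2 ⟨inferInstance, inferInstance⟩

section Transfer

variable {V : Type*} {G : SimpleGraph V} {n : ℕ} {f g : ℕ → ℕ} {pos : V → ℕ}

/-- If every vertex but the first one has a neighbour of smaller index, the graph is connected. -/
theorem IsBackPair.connected (h : IsBackPair n f g) (hinj : pos.Injective) (hle : ∀ x, pos x ≤ n)
    (hE : Sym2.map pos '' G.edgeSet = backEdges n f g) {x₀ : V} (hx₀ : pos x₀ = 0) :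
    G.Connected := by
  have reach : ∀ k x, pos x = k → G.Reachable x x₀ := by
    intro k
    induction k using Nat.strong_induction_on with
    | _ k ih =>
      intro x hx
      rcases Nat.eq_zero_or_pos k with rfl | hk
      · rw [hinj (hx.trans hx₀.symm)]
      · have hkn : k ≤ n := hx ▸ hle x
        have hmem : s(k, f k) ∈ (backEdges n f g : Set (Sym2 ℕ)) :=
          mem_backEdges.2 (Or.inl ⟨k, hk, hkn, rfl⟩)
        rw [← hE] at hmem
        obtain ⟨e, he, hek⟩ := hmem
        have hlt := h.left_lt' hk hkn
        induction e with | _ a b => ?_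
        rw [SimpleGraph.mem_edgeSet] at he
        rcases Sym2.eq_iff.1 hek with ⟨ha, hb⟩ | ⟨ha, hb⟩
        · obtain rfl : x = a := hinj (hx.trans ha.symm)
          exact he.reachable.trans (ih _ hlt b hb)
        · obtain rfl : x = b := hinj (hx.trans hb.symm)
          exact he.symm.reachable.trans (ih _ hlt a ha)
  exact { preconnected := fun x y => (reach _ x rfl).trans (reach _ y rfl).symm
          nonempty := ⟨x₀⟩ }

theorem IsBackPair.natCard_edgeSet (h : IsBackPair n f g) (hn : 3 ≤ n) (hinj : pos.Injective)
    (hE : Sym2.map pos '' G.edgeSet = backEdges n f g) : Nat.card G.edgeSet = 2 * n := by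
  rw [Nat.card_coe_set_eq, ← Set.ncard_image_of_injective _ (Sym2.map.injective hinj), hE,
    Set.ncard_coe_finset, h.card_backEdges hn]

theorem IsBackPair.betti_eq (h : IsBackPair n f g) (hn : 3 ≤ n) (hinj : pos.Injective)
    (hE : Sym2.map pos '' G.edgeSet = backEdges n f g) (hG : G.Connected)
    (hV : Nat.card V = n + 1) : betti G = n := by
  rw [betti, h.natCard_edgeSet hn hinj hE, hG.natCard_connectedComponent, hV]
  push_cast
  ring

theorem IsBackPair.primLogDivergent [Finite V] (h : IsBackPair n f g) (hn : 3 ≤ n) (hinj : pos.Injective)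
    (hE : Sym2.map pos '' G.edgeSet = backEdges n f g) (hG : G.Connected)
    (hV : Nat.card V = n + 1) : PrimLogDivergent G := by
  refine ⟨?_, fun F hFG hFne hFE hF => ?_⟩
  · rw [LogDivergent, h.betti_eq hn hinj hE hG hV, h.natCard_edgeSet hn hinj hE]
    push_cast
    ring
  · have hinj' := Sym2.map.injective hinj
    obtain ⟨F', hF'⟩ := (Set.toFinite (Sym2.map pos '' F)).exists_finset_coe
    obtain ⟨S, hS⟩ := (Set.toFinite (pos '' edgeSupport F)).exists_finset_coe
    have hF'E : F' ⊂ backEdges n f g := by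
      rw [← Finset.coe_ssubset, hF', ← hE]
      exact (Set.image_mono hFG).ssubset_of_ne fun h' => hFE (hinj'.image_injective h')
    have hF'ne : F'.Nonempty := by
      rw [← Finset.coe_nonempty, hF']
      exact hFne.image _
    have hmem : ∀ k, k ∈ S ↔ ∃ e ∈ F', k ∈ e := by
      intro k
      rw [← Finset.mem_coe, hS]
      simp only [← Finset.mem_coe, hF', edgeSupport]
      constructor
      · rintro ⟨x, ⟨e, he, hx⟩, rfl⟩
        exact ⟨_, ⟨e, he, rfl⟩, Sym2.mem_map.2 ⟨x, hx, rfl⟩⟩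
      · rintro ⟨_, ⟨e, he, rfl⟩, hk⟩
        obtain ⟨x, hx, rfl⟩ := Sym2.mem_map.1 hk
        exact ⟨x, ⟨e, he, hx⟩, rfl⟩
    have key := h.card_add_three_le hn hF'E hF'ne hmem
    have hFcard : Nat.card F = F'.card := by
      rw [Nat.card_coe_set_eq, ← Set.ncard_image_of_injective _ hinj', ← hF', Set.ncard_coe_finset]
    have hScard : Nat.card (edgeSupport F) = S.card := by
      rw [Nat.card_coe_set_eq, ← Set.ncard_image_of_injective _ hinj, ← hS, Set.ncard_coe_finset]
    rw [ConvergentEdges, bettiOfEdges, hF.natCard_connectedComponent, hFcard, hScard]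
    omega

end Transfer

section Gzz

variable {t : ℕ} {l : Fin t → ℕ}

/-- The total length `l₁ + ⋯ + l_k` of the first `k` blocks. -/
def blockStart (l : Fin t → ℕ) (k : ℕ) : ℕ := ∑ i : Fin t, if (i : ℕ) < k then l i else 0

theorem blockStart_zero : blockStart l 0 = 0 := by simp [blockStart]

theorem blockStart_last : blockStart l t = ∑ i, l i := by simp [blockStart]

theorem blockStart_succ (i : Fin t) : blockStart l (i + 1) = blockStart l i + l i := by
  have h : ∀ j : Fin t, (if (j : ℕ) < i + 1 then l j else 0) =
      (if (j : ℕ) < i then l j else 0) + if j = i then l j else 0 := by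
    intro j
    rcases lt_trichotomy j i with hj | rfl | hj
    · have := hj.ne
      have : (j : ℕ) < i := hj
      have : (j : ℕ) < i + 1 := by omega
      simp [*]
    · simp
    · have := hj.ne'
      have : ¬ (j : ℕ) < i := by have : (i : ℕ) < j := hj; omega
      have : ¬ (j : ℕ) < i + 1 := by have : (i : ℕ) < j := hj; omega
      simp [*]
  simp only [blockStart, h, Finset.sum_add_distrib, Finset.sum_ite_eq', Finset.mem_univ, if_true]

theorem blockStart_mono : Monotone (blockStart l) := by
  intro a b hab
  refine Finset.sum_le_sum fun i _ => ?_
  split_ifs <;> omega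

theorem blockStart_le (k : ℕ) : blockStart l k ≤ ∑ i, l i := by
  refine Finset.sum_le_sum fun i _ => ?_
  split_ifs <;> omega

theorem blockStart_add_lt (i : Fin t) (j : Fin (l i)) : blockStart l i + j < ∑ i, l i := by
  have := blockStart_succ (l := l) i
  have := blockStart_le (l := l) (i + 1)
  omega

/-- The position of a vertex in the ordering `u₁, u₂, v_{1,1}, …, u₃, v_{2,1}, …, u_{t+2}`. -/
def gzzPos (l : Fin t → ℕ) : GzzV t l → ℕ
  | Sum.inl k => if (k : ℕ) = 0 then 0 else 1 + blockStart l (k - 1)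
  | Sum.inr ⟨i, j⟩ => 2 + blockStart l i + j

/-- The position of the `j`-th vertex (0-indexed) of the `i`-th block
`v_{i,1}, …, v_{i,l_i-1}, u_{i+2}`. -/
def blockPos (l : Fin t → ℕ) (d : Σ i : Fin t, Fin (l i)) : ℕ := 2 + blockStart l d.1 + d.2

theorem blockPos_injective : (blockPos l).Injective := by
  rintro ⟨i, j⟩ ⟨i', j'⟩ h
  simp only [blockPos] at h
  have := blockStart_succ (l := l) i
  have := blockStart_succ (l := l) i'
  rcases lt_trichotomy i i' with hi | rfl | hi
  · have := blockStart_mono (l := l) (show (i : ℕ) + 1 ≤ i' from hi)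
    omega
  · obtain rfl : j = j' := Fin.ext (by omega)
    rfl
  · have := blockStart_mono (l := l) (show (i' : ℕ) + 1 ≤ i from hi)
    omega

theorem exists_blockPos_eq {k : ℕ} (h2 : 2 ≤ k) (hk : k ≤ 1 + ∑ i, l i) :
    ∃ d, blockPos l d = k := by
  have key : ∀ m ≤ t, k - 2 < blockStart l m → ∃ d, blockPos l d = k := by
    intro m
    induction m with
    | zero => simp [blockStart_zero]
    | succ m ih =>
      intro hm hlt
      by_cases h : k - 2 < blockStart l m
      · exact ih (by omega) h
      · have := blockStart_succ (l := l) ⟨m, hm⟩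
        simp only at this
        exact ⟨⟨⟨m, hm⟩, ⟨k - 2 - blockStart l m, by omega⟩⟩, by simp only [blockPos]; omega⟩
  exact key t le_rfl (by rw [blockStart_last]; omega)

theorem gzzPos_pathVert_succ (i : Fin t) {j : ℕ} (hj : j < l i) :
    gzzPos l (gzzPathVert l i (j + 1)) = 2 + blockStart l i + j := by
  by_cases h : j + 1 < l i
  · simp [gzzPathVert, h, gzzPos]
  · have := blockStart_succ (l := l) i
    simp [gzzPathVert, h, gzzPos]
    omega

theorem gzzVert_cases (hl : ∀ i, 1 ≤ l i) (x : GzzV t l) :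
    x = Sum.inl 0 ∨ x = Sum.inl 1 ∨
      ∃ d : Σ i : Fin t, Fin (l i), x = gzzPathVert l d.1 (d.2 + 1) := by
  rcases x with ⟨k, hk⟩ | ⟨i, j⟩
  · match k, hk with
    | 0, _ => exact Or.inl rfl
    | 1, _ => exact Or.inr (Or.inl rfl)
    | k + 2, hk =>
      have := hl ⟨k, by omega⟩
      refine Or.inr (Or.inr ⟨⟨⟨k, by omega⟩, ⟨l ⟨k, by omega⟩ - 1, by omega⟩⟩, ?_⟩)
      simp [gzzPathVert, Nat.sub_add_cancel this, Nat.one_le_iff_ne_zero.1 this]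
  · refine Or.inr (Or.inr ⟨⟨i, ⟨j, by omega⟩⟩, ?_⟩)
    simp only [gzzPathVert]
    rw [dif_neg (by omega), dif_pos (by omega)]
    simp

theorem gzzPos_block (d : Σ i : Fin t, Fin (l i)) :
    gzzPos l (gzzPathVert l d.1 (d.2 + 1)) = blockPos l d :=
  gzzPos_pathVert_succ d.1 d.2.isLt

theorem gzzPos_zero : gzzPos l (Sum.inl 0) = 0 := by simp [gzzPos]

theorem gzzPos_one : gzzPos l (Sum.inl 1) = 1 := by simp [gzzPos, blockStart_zero]

theorem two_le_blockPos (d : Σ i : Fin t, Fin (l i)) : 2 ≤ blockPos l d := by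
  simp only [blockPos]; omega

theorem blockPos_le (d : Σ i : Fin t, Fin (l i)) : blockPos l d ≤ 1 + ∑ i, l i := by
  have := blockStart_add_lt d.1 d.2
  simp only [blockPos]; omega

theorem gzzPos_injective (hl : ∀ i, 1 ≤ l i) : (gzzPos l).Injective := by
  intro x y hxy
  rcases gzzVert_cases hl x with rfl | rfl | ⟨d, rfl⟩ <;>
  rcases gzzVert_cases hl y with rfl | rfl | ⟨d', rfl⟩ <;>
  simp only [gzzPos_zero, gzzPos_one, gzzPos_block] at hxy
  · rfl
  · omega
  · have := two_le_blockPos d'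
    omega
  · omega
  · rfl
  · have := two_le_blockPos d'
    omega
  · have := two_le_blockPos d
    omega
  · have := two_le_blockPos d
    omega
  · rw [blockPos_injective hxy]

theorem gzzPos_le (hl : ∀ i, 1 ≤ l i) (x : GzzV t l) : gzzPos l x ≤ 1 + ∑ i, l i := by
  rcases gzzVert_cases hl x with rfl | rfl | ⟨d, rfl⟩
  · simp [gzzPos_zero]
  · simp [gzzPos_one]
  · exact (gzzPos_block d).trans_le (blockPos_le d)

/-- The position of the preceding vertex on the path through the block of `k`. -/
noncomputable def gzzLeft (l : Fin t → ℕ) : ℕ → ℕ :=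
  Function.extend (blockPos l) (fun d => gzzPos l (gzzPathVert l d.1 d.2)) 0

/-- The position of the apex `u_{i+1}` of the block of `k`. -/
noncomputable def gzzRight (l : Fin t → ℕ) : ℕ → ℕ :=
  Function.extend (blockPos l) (fun d => 1 + blockStart l d.1) 0

theorem gzzLeft_blockPos (d : Σ i : Fin t, Fin (l i)) :
    gzzLeft l (blockPos l d) = gzzPos l (gzzPathVert l d.1 d.2) :=
  blockPos_injective.extend_apply _ _ d

theorem gzzRight_blockPos (d : Σ i : Fin t, Fin (l i)) :
    gzzRight l (blockPos l d) = 1 + blockStart l d.1 :=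
  blockPos_injective.extend_apply _ _ d

theorem gzzLeft_one : gzzLeft l 1 = 0 :=
  Function.extend_apply' _ _ _ fun ⟨d, hd⟩ => by have := two_le_blockPos d; omega

theorem isBackPair_gzz (hl : ∀ i, 1 ≤ l i) :
    IsBackPair (1 + ∑ i, l i) (gzzLeft l) (gzzRight l) := by
  have key : ∀ k, 2 ≤ k → k ≤ 1 + ∑ i, l i →
      gzzLeft l k < k ∧ gzzRight l k < k ∧ gzzLeft l k ≠ gzzRight l k ∧
      (gzzLeft l k = k - 1 ∨ gzzRight l k = k - 1) ∧
      (3 ≤ k → 1 ≤ gzzLeft l k) ∧ (3 ≤ k → 1 ≤ gzzRight l k) := by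
    intro k h2 hk
    obtain ⟨⟨i, j, hj⟩, rfl⟩ := exists_blockPos_eq h2 hk
    rw [gzzLeft_blockPos, gzzRight_blockPos]
    rcases j with _ | j
    · obtain ⟨i, hi⟩ := i
      rcases i with _ | i
      · simp [gzzPathVert, gzzPos, blockPos, blockStart_zero]
      · have h1 := blockStart_succ (l := l) ⟨i, by omega⟩
        have h2 := hl ⟨i, by omega⟩
        simp only at h1
        simp only [gzzPathVert, gzzPos, blockPos, dif_pos, Nat.add_one_ne_zero, if_false,
          Nat.add_sub_cancel]
        omega
    · simp only [gzzPos_pathVert_succ i (by omega : j < l i), blockPos]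
      omega
  exact
    { one := gzzLeft_one
      left_lt := fun k h2 hk => (key k h2 hk).1
      right_lt := fun k h2 hk => (key k h2 hk).2.1
      ne := fun k h2 hk => (key k h2 hk).2.2.1
      pred := fun k h2 hk => (key k h2 hk).2.2.2.1
      left_pos := fun k h3 hk => (key k (by omega) hk).2.2.2.2.1 h3
      right_pos := fun k h3 hk => (key k (by omega) hk).2.2.2.2.2 h3 }

/-- Each block vertex is joined to its predecessor on the path of the block and to the apex
`u_{i+1}`; the remaining edges are `u₁ u₂` and `u₁ u_{t+2}`. -/
theorem mem_gzzEdges_iff (hl : ∀ i, 1 ≤ l i) (e : Sym2 (GzzV t l)) :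
    e ∈ gzzEdges t l ↔ e = s(Sum.inl 1, Sum.inl 0) ∨
      (∃ d : Σ i : Fin t, Fin (l i),
        e = s(gzzPathVert l d.1 (d.2 + 1), gzzPathVert l d.1 d.2)) ∨
      (∃ d : Σ i : Fin t, Fin (l i),
        e = s(gzzPathVert l d.1 (d.2 + 1), Sum.inl d.1.succ.castSucc)) ∨
      e = s(Sum.inl 0, Sum.inl (Fin.last (t + 1))) := by
  constructor
  · rintro (⟨⟨i, hi⟩, rfl⟩ | ⟨i, j, hj, rfl⟩ | ⟨i, j, rfl⟩ | rfl)
    · rcases i with _ | i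
      · exact Or.inl Sym2.eq_swap
      · have := hl ⟨i, by omega⟩
        refine Or.inr (Or.inr (Or.inl ⟨⟨⟨i, by omega⟩, ⟨l ⟨i, by omega⟩ - 1, by omega⟩⟩, ?_⟩))
        rw [Sym2.eq_swap]
        simp [gzzPathVert, Nat.sub_add_cancel this, Nat.one_le_iff_ne_zero.1 this]
    · exact Or.inr (Or.inl ⟨⟨i, ⟨j, hj⟩⟩, Sym2.eq_swap⟩)
    · refine Or.inr (Or.inr (Or.inl ⟨⟨i, ⟨j, by omega⟩⟩, ?_⟩))
      simp only [gzzPathVert]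
      rw [dif_neg (by omega), dif_pos (by omega)]
      rfl
    · exact Or.inr (Or.inr (Or.inr rfl))
  · rintro (rfl | ⟨⟨i, j, hj⟩, rfl⟩ | ⟨⟨i, j, hj⟩, rfl⟩ | rfl)
    · exact Or.inl ⟨0, Sym2.eq_swap⟩
    · exact Or.inr (Or.inl ⟨i, j, hj, Sym2.eq_swap⟩)
    · by_cases h : j + 1 < l i
      · refine Or.inr (Or.inr (Or.inl ⟨i, ⟨j, by omega⟩, ?_⟩))
        simp only [gzzPathVert]
        rw [dif_neg (by omega), dif_pos (by omega)]
        rfl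
      · refine Or.inl ⟨i.succ, ?_⟩
        simp only [gzzPathVert]
        rw [dif_neg (by omega), dif_neg (by omega), Sym2.eq_swap]
        rfl
    · exact Or.inr (Or.inr (Or.inr rfl))

theorem gzzPos_last : gzzPos l (Sum.inl (Fin.last (t + 1))) = 1 + ∑ i, l i := by
  simp [gzzPos, blockStart_last]

theorem gzzPos_apex (i : Fin t) :
    gzzPos l (Sum.inl i.succ.castSucc) = 1 + blockStart l i := by
  simp [gzzPos]

theorem image_gzzEdges (hl : ∀ i, 1 ≤ l i) :
    Sym2.map (gzzPos l) '' gzzEdges t l =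
      backEdges (1 + ∑ i, l i) (gzzLeft l) (gzzRight l) := by
  ext e
  rw [Finset.mem_coe, mem_backEdges]
  constructor
  · rintro ⟨e, he, rfl⟩
    rcases (mem_gzzEdges_iff hl e).1 he with rfl | ⟨d, rfl⟩ | ⟨d, rfl⟩ | rfl
    · refine Or.inl ⟨1, le_rfl, by omega, ?_⟩
      rw [Sym2.map_mk, gzzPos_one, gzzPos_zero, gzzLeft_one]
    · refine Or.inl ⟨blockPos l d, by have := two_le_blockPos d; omega, blockPos_le d, ?_⟩
      rw [Sym2.map_mk, gzzPos_block, gzzLeft_blockPos]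
    · refine Or.inr (Or.inl ⟨blockPos l d, two_le_blockPos d, blockPos_le d, ?_⟩)
      rw [Sym2.map_mk, gzzPos_block, gzzRight_blockPos, gzzPos_apex]
    · rw [Sym2.map_mk, gzzPos_zero, gzzPos_last]
      exact Or.inr (Or.inr rfl)
  · rintro (⟨k, h1, hk, rfl⟩ | ⟨k, h2, hk, rfl⟩ | rfl)
    · rcases h1.eq_or_lt with rfl | h2
      · refine ⟨_, (mem_gzzEdges_iff hl _).2 (Or.inl rfl), ?_⟩
        rw [Sym2.map_mk, gzzPos_one, gzzPos_zero, gzzLeft_one]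
      · obtain ⟨d, rfl⟩ := exists_blockPos_eq h2 hk
        refine ⟨_, (mem_gzzEdges_iff hl _).2 (Or.inr (Or.inl ⟨d, rfl⟩)), ?_⟩
        rw [Sym2.map_mk, gzzPos_block, gzzLeft_blockPos]
    · obtain ⟨d, rfl⟩ := exists_blockPos_eq h2 hk
      refine ⟨_, (mem_gzzEdges_iff hl _).2 (Or.inr (Or.inr (Or.inl ⟨d, rfl⟩))), ?_⟩
      rw [Sym2.map_mk, gzzPos_block, gzzRight_blockPos, gzzPos_apex]
    · refine ⟨_, (mem_gzzEdges_iff hl _).2 (Or.inr (Or.inr (Or.inr rfl))), ?_⟩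
      rw [Sym2.map_mk, gzzPos_zero, gzzPos_last]

theorem gzz_edgeSet (hl : ∀ i, 1 ≤ l i) (hn : 3 ≤ 1 + ∑ i, l i) :
    (gzz t l).edgeSet = gzzEdges t l := by
  rw [gzz, SimpleGraph.edgeSet_fromEdgeSet, sdiff_eq_left, Set.disjoint_left]
  intro e he hdiag
  have hmem : Sym2.map (gzzPos l) e ∈ backEdges (1 + ∑ i, l i) (gzzLeft l) (gzzRight l) := by
    rw [← Finset.mem_coe, ← image_gzzEdges hl]
    exact Set.mem_image_of_mem _ he
  exact (isBackPair_gzz hl).not_isDiag hn hmem (Sym2.IsDiag.map hdiag)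

theorem natCard_gzzV (hl : ∀ i, 1 ≤ l i) : Nat.card (GzzV t l) = (1 + ∑ i, l i) + 1 := by
  have h : ∑ i, l i = ∑ i, (l i - 1) + t := by
    conv_lhs => rw [Finset.sum_congr rfl fun i _ => (Nat.sub_add_cancel (hl i)).symm]
    simp [Finset.sum_add_distrib]
  simp only [Nat.card_eq_fintype_card, Fintype.card_sum, Fintype.card_fin, Fintype.card_sigma]
  omega

end Gzz

/-- Theorem 2.2.5: every generalized zigzag graph `GZZ(l₁,…,l_t)` (with `t ≥ 1`,
all `l_i ≥ 1`, `l₁ ≥ 2` and `l_t ≥ 2`) is primitively log divergent; in particular,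
with `n = 1 + l₁ + ⋯ + l_t`, it has `n+1` vertices, `2n` edges and first Betti number
`h₁ = n`. -/
theorem gzz_primLogDivergent (t : ℕ) (ht : 1 ≤ t) (l : Fin t → ℕ)
    (hl : ∀ i, 1 ≤ l i)
    (hfirst : 2 ≤ l ⟨0, by omega⟩) (hlast : 2 ≤ l ⟨t-1, by omega⟩) :
    PrimLogDivergent (gzz t l) ∧
    Nat.card (GzzV t l) = (1 + ∑ i, l i) + 1 ∧
    Nat.card (gzz t l).edgeSet = 2 * (1 + ∑ i, l i) ∧
    betti (gzz t l) = ((1 + ∑ i, l i : ℕ) : ℤ) := by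
  have hn : 3 ≤ 1 + ∑ i, l i := by
    have := Finset.single_le_sum (fun i _ => Nat.zero_le (l i)) (Finset.mem_univ ⟨0, by omega⟩)
    omega
  have h := isBackPair_gzz hl
  have hinj := gzzPos_injective hl
  have hE : Sym2.map (gzzPos l) '' (gzz t l).edgeSet =
      backEdges (1 + ∑ i, l i) (gzzLeft l) (gzzRight l) := by
    rw [gzz_edgeSet hl hn, image_gzzEdges hl]
  have hG := h.connected hinj (gzzPos_le hl) hE gzzPos_zero
  have hV := natCard_gzzV hl
  exact ⟨h.primLogDivergent hn hinj hE hG hV, hV, h.natCard_edgeSet hn hinj hE,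
    h.betti_eq hn hinj hE hG hV⟩
end

section
/- Let Γ be a connected primitively log divergent simple graph with exactly 6 edges. Then Γ is isomorphic as a simple graph to the complete graph K₄ on four vertices (equivalently, to the wheel WS₃). -/
/-- A simple graph on `n` vertices with `n.choose 2` edges is complete. -/
theorem SimpleGraph.eq_top_of_card_edgeSet {V : Type*} [Finite V] (G : SimpleGraph V)
    (h : Nat.card G.edgeSet = (Nat.card V).choose 2) : G = ⊤ := by
  classical
  have := Fintype.ofFinite V
  rw [Nat.card_eq_fintype_card, Nat.card_eq_fintype_card, ← SimpleGraph.edgeFinset_card,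
    ← SimpleGraph.card_edgeFinset_top_eq_card_choose_two] at h
  exact SimpleGraph.edgeFinset_inj.mp <|
    Finset.eq_of_subset_of_card_le (SimpleGraph.edgeFinset_mono le_top) h.ge

/-- A connected primitively log divergent simple graph with exactly `6` edges is
isomorphic to the complete graph `K₄` on four vertices (equivalently, to `WS₃`). -/
theorem primLogDivergent_six_edges {V : Type*} [Fintype V]
    (G : SimpleGraph V) (hconn : G.Connected) (hpld : PrimLogDivergent G)
    (hcard : Nat.card G.edgeSet = 6) :
    Nonempty (G ≃g (⊤ : SimpleGraph (Fin 4))) := by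
  have hc : Nat.card G.ConnectedComponent = 1 := by
    have := hconn.preconnected.subsingleton_connectedComponent
    have := hconn.nonempty
    exact Nat.card_eq_one_iff_unique.mpr ⟨inferInstance, ⟨G.connectedComponentMk this.some⟩⟩
  have hlog := hpld.1
  simp only [LogDivergent, betti, hcard, hc] at hlog
  have hV : Nat.card V = 4 := by omega
  have hG : G = ⊤ := G.eq_top_of_card_edgeSet (by rw [hcard, hV]; rfl)
  subst hG
  exact ⟨SimpleGraph.Iso.completeGraph (Finite.equivFinOfCardEq hV)⟩
end

section
/- Let Γ be a connected primitively log divergent simple graph with exactly 8 edges. Then Γ is isomorphic as a simple graph to the wheel with four spokes WS₄. -/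
/-- The successor of a rim index, cyclically (`i ↦ i+1 mod n`). -/
def rimNext {n : ℕ} (i : Fin n) : Fin n := ⟨((i : ℕ) + 1) % n, Nat.mod_lt _ i.pos⟩

/-- The wheel with `n` spokes `WS_n`: vertex `0` is the hub, the vertices `1,…,n` lie
on the rim; the edges are the spokes `v₀ v_i` and the rim edges `v_i v_{i+1}`
(indices mod `n`). -/
def wheel (n : ℕ) : SimpleGraph (Fin (n+1)) :=
  SimpleGraph.fromEdgeSet
    {e : Sym2 (Fin (n+1)) |
      (∃ i : Fin n, e = s((0 : Fin (n+1)), i.succ)) ∨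
      (∃ i : Fin n, e = s(i.succ, (rimNext i).succ))}

theorem wheel_four_adj (i j : Fin 5) :
    (wheel 4).Adj i j ↔ i ≠ j ∧ s(i, j) ≠ s(1, 3) ∧ s(i, j) ≠ s(2, 4) := by
  simp only [wheel, SimpleGraph.fromEdgeSet_adj, Set.mem_ofPred_eq, rimNext]
  revert i j
  decide

theorem nonempty_iso_wheel_four {V : Type*} [Fintype V] (G : SimpleGraph V)
    (hV : Fintype.card V = 5) {b c d e : V}
    (hadj : ∀ x y, G.Adj x y ↔ x ≠ y ∧ s(x, y) ≠ s(b, c) ∧ s(x, y) ≠ s(d, e))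
    (hbc : b ≠ c) (hde : d ≠ e) (hbd : b ≠ d) (hbe : b ≠ e) (hcd : c ≠ d) (hce : c ≠ e) :
    Nonempty (G ≃g wheel 4) := by
  classical
  obtain ⟨a, ha⟩ : ∃ a, a ∉ ({b, c, d, e} : Finset V) := by
    by_contra! h
    have h₁ : ({b, c, d, e} : Finset V) = Finset.univ := Finset.eq_univ_iff_forall.2 h
    have h₂ := Finset.card_le_four (a := b) (b := c) (c := d) (d := e)
    rw [h₁, Finset.card_univ] at h₂
    omega
  simp only [Finset.mem_insert, Finset.mem_singleton, not_or] at ha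
  obtain ⟨hab, hac, had, hae⟩ := ha
  let f : Fin 5 → V := ![a, b, d, c, e]
  have hf : Function.Injective f := by
    intro i j hij
    fin_cases i <;> fin_cases j <;> simp_all [f, eq_comm]
  have hbij : Function.Bijective f :=
    (Fintype.bijective_iff_injective_and_card f).2 ⟨hf, by simp [hV]⟩
  refine ⟨(RelIso.symm ⟨Equiv.ofBijective f hbij, ?_⟩)⟩
  intro i j
  have hs : ∀ k l : Fin 5, s(f i, f j) = s(f k, f l) ↔ s(i, j) = s(k, l) := fun k l =>
    (Sym2.map.injective hf).eq_iff (a := s(i, j)) (b := s(k, l))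
  rw [wheel_four_adj, Equiv.ofBijective_apply, Equiv.ofBijective_apply, hadj, hf.ne_iff]
  exact and_congr Iff.rfl (and_congr (hs 1 3).not (hs 2 4).not)

theorem connected_spannedSubgraph_of_pairwise {V : Type*} {F : Set (Sym2 V)} (hF : F.Nonempty)
    (h : ∀ x ∈ edgeSupport F, ∀ y ∈ edgeSupport F, x ≠ y → s(x, y) ∈ F) :
    (spannedSubgraph F).Connected := by
  obtain ⟨e, he⟩ := hF
  have : Nonempty (edgeSupport F) := ⟨⟨e.out.1, e, he, e.out_fst_mem⟩⟩
  have htop : spannedSubgraph F = ⊤ := by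
    ext x y
    simp only [spannedSubgraph, SimpleGraph.comap_adj, SimpleGraph.fromEdgeSet_adj,
      SimpleGraph.top_adj, Function.Embedding.subtype_apply]
    exact ⟨fun hxy => Subtype.coe_ne_coe.1 hxy.2,
      fun hxy => ⟨h x x.2 y y.2 (Subtype.coe_ne_coe.2 hxy), Subtype.coe_ne_coe.2 hxy⟩⟩
  rw [htop]
  exact SimpleGraph.connected_top

theorem not_primLogDivergent_of_compl_edges_share_vertex {V : Type*} [Fintype V]
    (G : SimpleGraph V) (hV : Fintype.card V = 5) (hcard : Nat.card G.edgeSet = 8) {a b c : V}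
    (hadj : ∀ x y, G.Adj x y ↔ x ≠ y ∧ s(x, y) ≠ s(a, b) ∧ s(x, y) ≠ s(a, c))
    (hab : a ≠ b) (hac : a ≠ c) (hbc : b ≠ c) : ¬ PrimLogDivergent G := by
  classical
  intro hpld
  have hdeg : G.degree a ≤ 2 := by
    have hsub : G.neighborFinset a ⊆ ({a, b, c} : Finset V)ᶜ := by
      intro x hx
      rw [SimpleGraph.mem_neighborFinset, hadj] at hx
      simp only [Finset.mem_compl, Finset.mem_insert, Finset.mem_singleton]
      rintro (rfl | rfl | rfl) <;> simp_all
    have h := Finset.card_le_card hsub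
    rwa [Finset.card_compl, hV, Finset.card_eq_three.2 ⟨a, b, c, hab, hac, hbc, rfl⟩] at h
  obtain ⟨d, hd⟩ : ∃ d, d ∉ ({a, b, c} : Finset V) := by
    by_contra! h
    have h₁ : ({a, b, c} : Finset V) = Finset.univ := Finset.eq_univ_iff_forall.2 h
    have h₂ := Finset.card_le_three (a := a) (b := b) (c := c)
    rw [h₁, Finset.card_univ] at h₂
    omega
  simp only [Finset.mem_insert, Finset.mem_singleton, not_or] at hd
  have had : G.Adj a d := by
    rw [hadj]
    simp only [ne_eq, Sym2.eq_iff]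
    grind
  set F : Set (Sym2 V) := (G.deleteIncidenceSet a).edgeSet with hFdef
  have hFcard : 6 ≤ Nat.card F := by
    have h := G.card_edgeFinset_deleteIncidenceSet a
    rw [SimpleGraph.edgeFinset_card, SimpleGraph.edgeFinset_card, ← Nat.card_eq_fintype_card,
      ← Nat.card_eq_fintype_card, ← hFdef, hcard] at h
    omega
  have hmem : ∀ x y, s(x, y) ∈ F ↔ G.Adj x y ∧ x ≠ a ∧ y ≠ a := fun x y => by
    rw [hFdef, SimpleGraph.mem_edgeSet, SimpleGraph.deleteIncidenceSet_adj]
  have hne : F.Nonempty := by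
    rw [Set.nonempty_iff_ne_empty]
    intro h
    rw [h] at hFcard
    simp at hFcard
  have hsupp : edgeSupport F ⊆ {a}ᶜ := by
    rintro x ⟨e, he, hxe⟩
    obtain ⟨y, rfl⟩ := hxe
    exact ((hmem x y).1 he).2.1
  have hsuppcard : Nat.card (edgeSupport F) ≤ 4 := by
    have h := Nat.card_mono (Set.toFinite _) hsupp
    rw [Nat.card_eq_fintype_card (α := ({a}ᶜ : Set V)), Fintype.card_compl_set, hV] at h
    simpa using h
  have hconn : (spannedSubgraph F).Connected := by
    refine connected_spannedSubgraph_of_pairwise hne fun x hx y hy hxy => ?_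
    have hx' : x ≠ a := hsupp hx
    have hy' : y ≠ a := hsupp hy
    refine (hmem x y).2 ⟨(hadj x y).2 ⟨hxy, ?_⟩, hx', hy'⟩
    simp only [ne_eq, Sym2.eq_iff]
    grind
  have hconv := hpld.2 F (SimpleGraph.edgeSet_mono (G.deleteIncidenceSet_le a)) hne
    (fun h => ((hmem a d).1 (h ▸ had)).2.1 rfl) hconn
  have hcomp : Nat.card (spannedSubgraph F).ConnectedComponent = 1 :=
    have := hconn.preconnected.subsingleton_connectedComponent
    have := hconn.nonempty
    Nat.card_unique
  rw [ConvergentEdges, bettiOfEdges, hcomp] at hconv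
  omega

theorem exists_compl_edges_of_card_edgeSet {V : Type*} [Fintype V] (G : SimpleGraph V)
    (hV : Fintype.card V = 5) (hcard : Nat.card G.edgeSet = 8) :
    ∃ b c d e : V, b ≠ c ∧ d ≠ e ∧ s(b, c) ≠ s(d, e) ∧
      ∀ x y, G.Adj x y ↔ x ≠ y ∧ s(x, y) ≠ s(b, c) ∧ s(x, y) ≠ s(d, e) := by
  classical
  have h2 : ((⊤ : SimpleGraph V).edgeFinset \ G.edgeFinset).card = 2 := by
    rw [Finset.card_sdiff_of_subset (SimpleGraph.edgeFinset_mono le_top),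
      SimpleGraph.card_edgeFinset_top_eq_card_choose_two, hV, SimpleGraph.edgeFinset_card,
      ← Nat.card_eq_fintype_card, hcard]
    rfl
  obtain ⟨p, q, hpq, hset⟩ := Finset.card_eq_two.1 h2
  induction p with | _ b c
  induction q with | _ d e
  have key : ∀ x y, (x ≠ y ∧ ¬ G.Adj x y) ↔ s(x, y) = s(b, c) ∨ s(x, y) = s(d, e) := by
    intro x y
    have h := Finset.ext_iff.1 hset s(x, y)
    rwa [Finset.mem_sdiff, SimpleGraph.mem_edgeFinset, SimpleGraph.mem_edgeFinset,
      SimpleGraph.mem_edgeSet, SimpleGraph.mem_edgeSet, SimpleGraph.top_adj, Finset.mem_insert,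
      Finset.mem_singleton] at h
  refine ⟨b, c, d, e, ((key b c).2 (Or.inl rfl)).1, ((key d e).2 (Or.inr rfl)).1, hpq,
    fun x y => ?_⟩
  have h := key x y
  have hne : G.Adj x y → x ≠ y := SimpleGraph.Adj.ne
  tauto

/-- A connected primitively log divergent simple graph with exactly `8` edges is
isomorphic to the wheel with four spokes `WS₄`. -/
theorem primLogDivergent_eight_edges {V : Type*} [Fintype V]
    (G : SimpleGraph V) (hconn : G.Connected) (hpld : PrimLogDivergent G)
    (hcard : Nat.card G.edgeSet = 8) :
    Nonempty (G ≃g wheel 4) := by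
  have hcomp : Nat.card G.ConnectedComponent = 1 :=
    have := hconn.preconnected.subsingleton_connectedComponent
    have := hconn.nonempty
    Nat.card_unique
  have hV : Fintype.card V = 5 := by
    have h := hpld.1
    rw [LogDivergent, betti, hcomp, hcard, Nat.card_eq_fintype_card] at h
    omega
  obtain ⟨b, c, d, e, hbc, hde, hne, hadj⟩ := exists_compl_edges_of_card_edgeSet G hV hcard
  have hshare : ∀ {u v w : V}, u ≠ v → u ≠ w → v ≠ w →
      ¬ ∀ x y, G.Adj x y ↔ x ≠ y ∧ s(x, y) ≠ s(u, v) ∧ s(x, y) ≠ s(u, w) :=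
    fun huv huw hvw h =>
      not_primLogDivergent_of_compl_edges_share_vertex G hV hcard h huv huw hvw hpld
  refine nonempty_iso_wheel_four G hV hadj hbc hde ?_ ?_ ?_ ?_ <;> rintro rfl
  · exact hshare hbc hde (fun h => hne (h ▸ rfl)) hadj
  · rw [Sym2.eq_swap (a := d)] at hne hadj
    exact hshare hbc hde.symm (fun h => hne (h ▸ rfl)) hadj
  · rw [Sym2.eq_swap (a := b)] at hne
    simp only [Sym2.eq_swap (a := b) (b := c)] at hadj
    exact hshare hbc.symm hde (fun h => hne (h ▸ rfl)) hadj
  · rw [Sym2.eq_swap (a := b), Sym2.eq_swap (a := d)] at hne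
    simp only [Sym2.eq_swap (a := b) (b := c), Sym2.eq_swap (a := d) (b := c)] at hadj
    exact hshare hbc.symm hde.symm (fun h => hne (h ▸ rfl)) hadj
end
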